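/- arXiv:1501.05579 — 2 statements merged into one kernel-verified Lean document; each statement's English description precedes it below -/
import Mathlib

section
/- Let G = ⟨H, t | t a t⁻¹ = φ(a) for a ∈ A⟩ be an HNN extension with [H : A] ≥ 2 and [H : B] ≥ 2, and let η : Σ → G be a finite symmetric generating set of G. Then there exist constants C > 0 and 0 < ρ < 1 such that for every n ∈ ℕ the number of cyclically reduced words of length n over Σ representing elliptic elements of G is at most C·ρⁿ times the number of all cyclically reduced words of length n over Σ. -/
universe u

open Monoid

/-- The number of words of length `n` over `α` lying in `L`. -/
noncomputable def wordCount {α : Type*} (L : Set (List α)) (n : ℕ) : ℕ :=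
  Nat.card {w : List α // w ∈ L ∧ w.length = n}

/-- A set of words over a finite alphabet is strongly negligible: the number of its words of
length `n` is at most `C·ρⁿ·|Σ|ⁿ` for some constants `C > 0` and `0 < ρ < 1`. -/
def StronglyNegligible {α : Type*} [Fintype α] (L : Set (List α)) : Prop :=
  ∃ C ρ : ℝ, 0 < C ∧ 0 < ρ ∧ ρ < 1 ∧ ∀ n : ℕ,
    (wordCount L n : ℝ) ≤ C * ρ ^ n * (Fintype.card α : ℝ) ^ n

/-- A set of words is strongly generic if its complement is strongly negligible. -/
def StronglyGeneric {α : Type*} [Fintype α] (L : Set (List α)) : Prop :=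
  StronglyNegligible Lᶜ

/-- `η : α → G` together with the involution `inv` is a symmetric generating set:
`inv` is a fixed-point-free involution, `η (inv a) = (η a)⁻¹`, and the image of `η`
generates `G` as a group. -/
def IsSymmetricGen {α G : Type*} [Group G] (η : α → G) (inv : α → α) : Prop :=
  (∀ a, inv (inv a) = a) ∧ (∀ a, inv a ≠ a) ∧ (∀ a, η (inv a) = (η a)⁻¹) ∧
    Subgroup.closure (Set.range η) = ⊤

/-- The element of `G` represented by a word over `α`. -/
def evalWord {α G : Type*} [Monoid G] (η : α → G) (w : List α) : G :=
  (w.map η).prod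

/-- An element of `G` is elliptic with respect to the set `S` if it is conjugate in `G`
to an element of `S`. -/
def IsElliptic {G : Type*} [Group G] (S : Set G) (x : G) : Prop :=
  ∃ h ∈ S, IsConj h x

/-- A word is reduced (w.r.t. the involution `inv`) if no two consecutive letters are of
the form `a`, `inv a`. -/
def Reduced {α : Type*} (inv : α → α) (w : List α) : Prop :=
  List.Chain' (fun a b => b ≠ inv a) w

/-- A word is cyclically reduced if its concatenation with itself is reduced. -/
def CyclicallyReduced {α : Type*} (inv : α → α) (w : List α) : Prop :=
  Reduced inv (w ++ w)

section HNN
open HNNExtension HNNExtension.NormalWord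

variable {H : Type*} [Group H] {A B : Subgroup H} (φ : A ≃* B)

/-- Elements whose reduced form begins with `t^u` (up to the edge group). -/
def DD (u : ℤˣ) : Set (HNNExtension H A B φ) :=
  {g | ∃ w : ReducedWord H A B, w.prod φ = g ∧ w.toList.head?.map Prod.fst = some u ∧
    w.head ∈ toSubgroup A B (-u)}

theorem exists_red (g : HNNExtension H A B φ) : ∃ w : ReducedWord H A B, w.prod φ = g := by
  obtain ⟨d⟩ := TransversalPair.nonempty H A B
  exact ⟨((NormalWord.equiv φ d) g).toReducedWord, (NormalWord.equiv φ d).symm_apply_apply g⟩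

theorem mem_DD_iff (u : ℤˣ) (w : ReducedWord H A B) :
    w.prod φ ∈ DD φ u ↔
      (w.toList.head?.map Prod.fst = some u ∧ w.head ∈ toSubgroup A B (-u)) := by
  constructor
  · rintro ⟨w', h1, h2, h3⟩
    obtain ⟨h4, h5⟩ := ReducedWord.map_fst_eq_and_of_prod_eq φ h1
    have h6 := h5 u (by simp [h2])
    have h7 := congrArg List.head? h4
    rw [List.head?_map, List.head?_map, h2] at h7
    refine ⟨h7.symm, ?_⟩
    have := mul_mem h3 h6
    simpa using this
  · rintro ⟨h1, h2⟩
    exact ⟨w, rfl, h1, h2⟩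

theorem t_mul_mem_DD (u : ℤˣ) (g : HNNExtension H A B φ) (hg : g ∉ DD φ (-u)) :
    t ^ (u : ℤ) * g ∈ DD φ u := by
  obtain ⟨w, rfl⟩ := exists_red φ g
  rw [mem_DD_iff] at hg
  refine ⟨⟨1, (u, w.head) :: w.toList, ?_⟩, ?_, ?_, ?_⟩
  · have := w.chain
    cases hl : w.toList with
    | nil => simp
    | cons x l =>
      rw [hl] at this hg
      rw [List.isChain_cons_cons]
      refine ⟨fun hh => ?_, this⟩
      by_contra hne
      apply hg
      simp only [List.head?_cons, Option.map_some, neg_neg]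
      refine ⟨?_, hh⟩
      rcases Int.units_eq_one_or u with rfl | rfl <;>
      rcases Int.units_eq_one_or x.1 with h | h <;> simp_all
  · simp [ReducedWord.prod, mul_assoc]
  · simp
  · exact one_mem _

theorem DD_disj (u : ℤˣ) (g : HNNExtension H A B φ) (hg : g ∈ DD φ u) : g ∉ DD φ (-u) := by
  obtain ⟨w, rfl, h1, h2⟩ := hg
  rw [mem_DD_iff]
  rintro ⟨h3, -⟩
  rw [h1] at h3
  rcases Int.units_eq_one_or u with rfl | rfl <;> simp at h3

theorem of_mul_DD (u v : ℤˣ) (g : HNNExtension H A B φ) (hg : g ∈ DD φ u) (h : H)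
    (hm : of h * g ∈ DD φ v) : h ∈ toSubgroup A B (-u) := by
  obtain ⟨w, rfl, h1, h2⟩ := hg
  have : (of h * w.prod φ : HNNExtension H A B φ) =
      (⟨h * w.head, w.toList, w.chain⟩ : ReducedWord H A B).prod φ := by
    simp [ReducedWord.prod, mul_assoc]
  rw [this, mem_DD_iff] at hm
  obtain ⟨h3, h4⟩ := hm
  simp only [h1, Option.some.injEq] at h3 h4
  subst h3
  exact (Subgroup.mul_mem_cancel_right _ h2).1 h4

theorem tconj (u : ℤˣ) (b : H) (hb : b ∈ toSubgroup A B u) :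
    ∃ c : H, (t ^ (u : ℤ) * of b * (t ^ (u : ℤ))⁻¹ : HNNExtension H A B φ) = of c := by
  rcases Int.units_eq_one_or u with rfl | rfl
  · exact ⟨_, by simpa using (equiv_eq_conj (φ := φ) ⟨b, hb⟩).symm⟩
  · exact ⟨_, by simpa using (equiv_symm_eq_conj (φ := φ) ⟨b, hb⟩).symm⟩

/-- right multiplication of nonempty reduced lists by elements of `H` -/
theorem red_mul_of (w : ReducedWord H A B) (hw : w.toList ≠ []) (h : H) :
    ∃ w' : ReducedWord H A B, w'.prod φ = w.prod φ * of h ∧ w'.head = w.head ∧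
      w'.toList.map Prod.fst = w.toList.map Prod.fst := by
  obtain ⟨k, l, hl⟩ := w
  simp only at hw
  induction l using List.reverseRecOn with
  | nil => exact absurd rfl hw
  | append_singleton l x _ =>
    refine ⟨⟨k, l ++ [(x.1, x.2 * h)], ?_⟩, ?_, rfl, ?_⟩
    · rw [List.isChain_append] at hl ⊢
      refine ⟨hl.1, by simp, ?_⟩
      intro a ha b hb
      have := hl.2.2 a ha x (by simp)
      simp at hb
      subst hb
      exact this
    · simp [ReducedWord.prod, mul_assoc]
    · simp

theorem head?_map_fst {H : Type*} {l l' : List (ℤˣ × H)} (h : l.map Prod.fst = l'.map Prod.fst) :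
    l.head?.map Prod.fst = l'.head?.map Prod.fst := by
  have := congrArg List.head? h
  rwa [List.head?_map, List.head?_map] at this

theorem DD_mul_of (u : ℤˣ) (g : HNNExtension H A B φ) (hg : g ∈ DD φ u) (h : H) :
    g * of h ∈ DD φ u := by
  obtain ⟨w, rfl, h1, h2⟩ := hg
  obtain ⟨w', h3, h4, h5⟩ := red_mul_of φ w (by rintro h; simp [h] at h1) h
  exact ⟨w', h3, by rw [head?_map_fst h5, h1], by rwa [h4]⟩

theorem DD_mul_t (u e : ℤˣ) (g : HNNExtension H A B φ) (hg : g ∈ DD φ u) :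
    g * t ^ (e : ℤ) ∈ DD φ u ∨
      g * t ^ (e : ℤ) ∈ ((of : H →* HNNExtension H A B φ).range : Set _) := by
  obtain ⟨⟨k, l, hl⟩, rfl, h1, h2⟩ := hg
  induction l using List.reverseRecOn with
  | nil => simp at h1
  | append_singleton l x _ =>
    by_cases hc : x.2 ∈ toSubgroup A B x.1 ∧ e = - x.1
    · obtain ⟨c, hc'⟩ := tconj φ x.1 x.2 hc.1
      have hl' := hl
      rw [List.isChain_append] at hl
      have heq : (⟨k, l ++ [x], hl'⟩ : ReducedWord H A B).prod φ * t ^ (e : ℤ) =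
          (⟨k, l, hl.1⟩ : ReducedWord H A B).prod φ * of c := by
        rw [← hc', hc.2]
        simp [ReducedWord.prod, mul_assoc]
      rw [heq]
      cases l with
      | nil => right; exact ⟨k * c, by simp [ReducedWord.prod]⟩
      | cons y l =>
        left
        apply DD_mul_of
        rw [mem_DD_iff]
        exact ⟨by simpa using h1, h2⟩
    · left
      refine ⟨⟨k, l ++ [x] ++ [(e, 1)], ?_⟩, ?_, ?_, h2⟩
      · rw [List.isChain_append]
        refine ⟨hl, by simp, ?_⟩
        intro a ha b hb
        simp at ha hb
        subst ha hb
        intro h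
        by_contra hne
        apply hc
        refine ⟨h, ?_⟩
        simp only at hne
        rcases Int.units_eq_one_or e with rfl | rfl <;>
        rcases Int.units_eq_one_or x.1 with h | h <;> simp_all
      · simp [ReducedWord.prod, mul_assoc]
      · rw [List.head?_append_of_ne_nil _ (by simp)]; exact h1

/-- syllables -/
def Syl : Set (HNNExtension H A B φ) :=
  {z | (∃ h : H, z = of h) ∨ ∃ e : ℤˣ, z = t ^ (e : ℤ)}

theorem path_lemma (u : ℤˣ) (z : List (HNNExtension H A B φ)) (hz : ∀ s ∈ z, s ∈ Syl φ)
    (y : HNNExtension H A B φ) (k : H) (hy : of k⁻¹ * y ∈ DD φ u)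
    (hno : ∀ z', z' <+: z → y * z'.prod ∉ ((of : H →* HNNExtension H A B φ).range : Set _)) :
    of k⁻¹ * (y * z.prod) ∈ DD φ u := by
  induction z generalizing y with
  | nil => simpa using hy
  | cons s z ih =>
    have := ih (fun r hr => hz r (by simp [hr])) (y * s) ?_ ?_
    · simpa [mul_assoc] using this
    · rcases hz s (by simp) with ⟨h, rfl⟩ | ⟨e, rfl⟩
      · rw [← mul_assoc]; exact DD_mul_of φ u _ hy h
      · rw [← mul_assoc]
        rcases DD_mul_t φ u e _ hy with h | h
        · exact h
        · exfalso
          apply hno [t ^ (e : ℤ)] (by simp)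
          simp only [List.prod_singleton]
          rw [mul_assoc] at h
          exact (Subgroup.mul_mem_cancel_left (of : H →* HNNExtension H A B φ).range
            (MonoidHom.mem_range.2 ⟨k⁻¹, rfl⟩)).1 h
    · intro z' hz'
      have := hno (s :: z') (by simpa using hz')
      simpa [mul_assoc] using this

theorem elliptic_path (z : List (HNNExtension H A B φ)) (hz : ∀ s ∈ z, s ∈ Syl φ)
    (hell : ∃ (y : HNNExtension H A B φ) (h : H),
      z.prod = y⁻¹ * of h * y) :
    ∃ z', z' <+: z ∧ z'.prod⁻¹ * z.prod * z'.prod ∈ (of : H →* HNNExtension H A B φ).range := by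
  obtain ⟨y, h, hyh⟩ := hell
  obtain ⟨⟨k, l, hl⟩, rfl⟩ := exists_red φ y
  induction l generalizing k h with
  | nil =>
    refine ⟨[], by simp, ?_⟩
    rw [hyh]
    exact ⟨k⁻¹ * h * k, by simp [ReducedWord.prod]⟩
  | cons x l ih =>
    by_cases hno : ∀ z', z' <+: z → (⟨k, x :: l, hl⟩ : ReducedWord H A B).prod φ * z'.prod ∉
        ((of : H →* HNNExtension H A B φ).range : Set _)
    · set y := (⟨k, x :: l, hl⟩ : ReducedWord H A B).prod φ with hy
      have hy' : of k⁻¹ * y = (⟨1, x :: l, hl⟩ : ReducedWord H A B).prod φ := by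
        simp [hy, ReducedWord.prod]
      have h0 : of k⁻¹ * y ∈ DD φ x.1 := by
        rw [hy', mem_DD_iff]
        exact ⟨by simp, one_mem _⟩
      have h1 := path_lemma φ x.1 z hz y k h0 hno
      have h2 : of k⁻¹ * (y * z.prod) = of (k⁻¹ * h * k) * (of k⁻¹ * y) := by
        rw [hyh]; simp [mul_assoc]
      rw [h2] at h1
      have h3 := of_mul_DD φ _ _ _ h0 _ h1
      obtain ⟨c, hc⟩ := tconj φ (-x.1) _ h3
      refine ih c x.2 (by rw [List.isChain_cons] at hl; exact hl.2) ?_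
      rw [← hc, hyh, hy]
      simp [ReducedWord.prod, mul_assoc]
    · push Not at hno
      obtain ⟨z', hz', ⟨c, hc⟩⟩ := hno
      refine ⟨z', hz', ⟨c⁻¹ * h * c, ?_⟩⟩
      rw [hyh]
      simp [hc, mul_assoc]


/-- the coset space: vertices of the Bass-Serre tree -/
abbrev XX : Type _ := HNNExtension H A B φ ⧸ (of : H →* HNNExtension H A B φ).range

/-- the image of `DD` in the coset space -/
def EE (u : ℤˣ) : Set (XX φ) := {x | ∃ g ∈ DD φ u, (QuotientGroup.mk g : XX φ) = x}

theorem mk_mem_EE (u : ℤˣ) (g : HNNExtension H A B φ) :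
    (QuotientGroup.mk g : XX φ) ∈ EE φ u ↔ g ∈ DD φ u := by
  constructor
  · rintro ⟨g', h1, h2⟩
    rw [QuotientGroup.eq] at h2
    obtain ⟨h, hh⟩ := h2
    have := DD_mul_of φ u _ h1 h
    rw [hh] at this
    simpa using this
  · intro h
    exact ⟨g, h, rfl⟩

theorem t_smul_mem_EE (u : ℤˣ) (x : XX φ) (hx : x ∉ EE φ (-u)) :
    (t ^ (u : ℤ) : HNNExtension H A B φ) • x ∈ EE φ u := by
  induction x using QuotientGroup.induction_on with
  | H g =>
    rw [mk_mem_EE] at hx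
    exact (mk_mem_EE φ u _).2 (t_mul_mem_DD φ u g hx)

theorem EE_disj (u : ℤˣ) (x : XX φ) (hx : x ∈ EE φ u) : x ∉ EE φ (-u) := by
  induction x using QuotientGroup.induction_on with
  | H g =>
    rw [mk_mem_EE] at hx ⊢
    exact DD_disj φ u g hx

theorem of_smul_EE (u v : ℤˣ) (x : XX φ) (hx : x ∈ EE φ u) (h : H)
    (hh : h ∉ toSubgroup A B (-u)) :
    (of h : HNNExtension H A B φ) • x ∉ EE φ v := by
  induction x using QuotientGroup.induction_on with
  | H g =>
    rw [mk_mem_EE] at hx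
    intro h2
    exact hh (of_mul_DD φ u v g hx h ((mk_mem_EE φ v _).1 h2))

open Classical in
/-- one half of a paradoxical decomposition -/
noncomputable def pinj (u : ℤˣ) (h : H) (x : XX φ) : XX φ :=
  if x ∈ EE φ (-u) then
    (t ^ (u : ℤ) * of h * (t ^ (u : ℤ))⁻¹ * of h : HNNExtension H A B φ) • x
  else (t ^ (u : ℤ) * t ^ (u : ℤ) : HNNExtension H A B φ) • x

theorem pinj_aux (u : ℤˣ) (h : H) (hh : h ∉ toSubgroup A B u) (x : XX φ) :
    ∃ y, pinj φ u h x = (t ^ (u : ℤ) : HNNExtension H A B φ) • y ∧ y ∉ EE φ (-u) ∧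
      (x ∈ EE φ (-u) → y ∉ EE φ u) ∧ (x ∉ EE φ (-u) → y ∈ EE φ u) := by
  by_cases hx : x ∈ EE φ (-u)
  · have h1 : ∀ v, (of h : HNNExtension H A B φ) • x ∉ EE φ v := fun v =>
      of_smul_EE φ (-u) v x hx h (by simpa using hh)
    have h2 : (t ^ ((-u : ℤˣ) : ℤ) : HNNExtension H A B φ) • (of h : HNNExtension H A B φ) • x
        ∈ EE φ (-u) := t_smul_mem_EE φ (-u) _ (h1 _)
    have h3 : ∀ v, (of h : HNNExtension H A B φ) • (t ^ ((-u : ℤˣ) : ℤ) : HNNExtension H A B φ) •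
        (of h : HNNExtension H A B φ) • x ∉ EE φ v := fun v =>
      of_smul_EE φ (-u) v _ h2 h (by simpa using hh)
    refine ⟨_, ?_, h3 _, fun _ => h3 _, fun h => absurd hx h⟩
    simp [pinj, hx, smul_smul, mul_assoc]
  · have h1 := t_smul_mem_EE φ u x hx
    refine ⟨_, ?_, EE_disj φ u _ h1, fun h => absurd h hx, fun _ => h1⟩
    simp [pinj, hx, smul_smul]

theorem pinj_mem (u : ℤˣ) (h : H) (hh : h ∉ toSubgroup A B u) (x : XX φ) :
    pinj φ u h x ∈ EE φ u := by
  obtain ⟨y, h1, h2, -⟩ := pinj_aux φ u h hh x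
  rw [h1]
  exact t_smul_mem_EE φ u y h2

theorem pinj_inj (u : ℤˣ) (h : H) (hh : h ∉ toSubgroup A B u) :
    Function.Injective (pinj φ u h) := by
  intro x x' hxx
  obtain ⟨y, h1, h2, h3, h4⟩ := pinj_aux φ u h hh x
  obtain ⟨y', h1', h2', h3', h4'⟩ := pinj_aux φ u h hh x'
  have hy : y = y' := by
    rw [h1, h1'] at hxx
    exact MulAction.injective _ hxx
  subst hy
  by_cases hx : x ∈ EE φ (-u) <;> by_cases hx' : x' ∈ EE φ (-u)
  · simp only [pinj, hx, hx', if_true] at hxx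
    exact MulAction.injective _ hxx
  · exact absurd (h4' hx') (h3 hx)
  · exact absurd (h4 hx) (h3' hx')
  · simp only [pinj, hx, hx', if_false] at hxx
    exact MulAction.injective _ hxx

theorem pinj_sum (h h' : H) (hh : h ∉ A) (hh' : h' ∉ B) :
    Function.Injective (Sum.elim (pinj φ 1 h) (pinj φ (-1) h')) := by
  refine Function.Injective.sumElim (pinj_inj φ 1 h (by simpa using hh))
    (pinj_inj φ (-1) h' (by simpa using hh')) ?_
  intro x y hxy
  have h1 := pinj_mem φ 1 h (by simpa using hh) x
  have h2 := pinj_mem φ (-1) h' (by simpa using hh') y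
  rw [← hxy] at h2
  exact EE_disj φ 1 _ h1 h2

theorem not_comm (h : H) (hh : h ∉ A) : (t * of h : HNNExtension H A B φ) ≠ of h * t := by
  intro hc
  have := ReducedWord.toList_eq_nil_of_mem_of_range φ
    (⟨1, [(1, h), (-1, 1)], by simpa using fun h' => absurd h' hh⟩ : ReducedWord H A B) ?_
  · simp at this
  · refine ⟨h, ?_⟩
    simp [ReducedWord.prod, hc]

end HNN
section Ana
open scoped ENNReal

variable {G X : Type*} [Group G] [MulAction G X]

/-- real square-summable functions -/
abbrev L2 (X : Type*) := lp (fun _ : X => ℝ) 2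

theorem L2_summable (f : L2 X) : Summable fun x => (f x) ^ 2 := by
  have := (lp.memℓp f).summable (by norm_num)
  simpa using this

theorem L2_norm_sq (f : L2 X) : ‖f‖ ^ 2 = ∑' x, (f x) ^ 2 := by
  have := lp.norm_rpow_eq_tsum (p := 2) (by norm_num) f
  simpa using this

theorem memL2_of {f : X → ℝ} (hf : Summable fun x => (f x) ^ 2) : Memℓp f 2 := by
  apply memℓp_gen
  simpa using hf

/-- The permutation representation. -/
noncomputable def rho (g : G) : L2 X →ₗ[ℝ] L2 X where
  toFun f := ⟨fun x => f (g⁻¹ • x), memL2_of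
    ((L2_summable f).comp_injective (MulAction.injective (g⁻¹ : G)))⟩
  map_add' f f' := by ext x; rfl
  map_smul' c f := by ext x; rfl

@[simp] theorem rho_apply (g : G) (f : L2 X) (x : X) : rho g f x = f (g⁻¹ • x) := rfl

theorem rho_mul (g h : G) (f : L2 X) : rho (g * h) f = rho g (rho h f) := by
  ext x; simp [mul_smul]

@[simp] theorem rho_one (f : L2 X) : rho (1 : G) f = f := by
  ext x; simp

@[simp] theorem norm_rho (g : G) (f : L2 X) : ‖rho g f‖ = ‖f‖ := by
  rw [← sq_eq_sq₀ (norm_nonneg _) (norm_nonneg _), L2_norm_sq, L2_norm_sq]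
  exact (MulAction.toPerm (g⁻¹ : G)).tsum_eq (fun x => (f x) ^ 2)

theorem norm_rho_sub (g : G) (f f' : L2 X) : ‖rho g f - rho g f'‖ = ‖f - f'‖ := by
  rw [← map_sub, norm_rho]

/-- composition with an injection -/
noncomputable def compInj (i : X → X) (hi : Function.Injective i) (f : L2 X) : L2 X :=
  ⟨fun x => f (i x), memL2_of ((L2_summable f).comp_injective hi)⟩

theorem compInj_sub (i : X → X) (hi : Function.Injective i) (u v : G)
    (huv : ∀ x, i x = u • x ∨ i x = v • x) (f : L2 X) :
    ‖compInj i hi f - f‖ ^ 2 ≤ ‖rho u⁻¹ f - f‖ ^ 2 + ‖rho v⁻¹ f - f‖ ^ 2 := by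
  rw [L2_norm_sq, L2_norm_sq, L2_norm_sq, ← (L2_summable _).tsum_add (L2_summable _)]
  refine (L2_summable _).tsum_le_tsum ?_ ((L2_summable _).add (L2_summable _))
  intro x
  simp only [lp.coeFn_sub, Pi.sub_apply, rho_apply, inv_inv]
  change (f (i x) - f x) ^ 2 ≤ _
  rcases huv x with h | h <;> rw [h]
  · linarith [sq_nonneg (f (v • x) - f x)]
  · linarith [sq_nonneg (f (u • x) - f x)]

theorem aux_sq {a b c n : ℝ} (hb : 0 ≤ b) (hc : 0 ≤ c) (hn : 0 ≤ n)
    (h : a ^ 2 ≤ b ^ 2 + c ^ 2) (h1 : b ≤ n / 10) (h2 : c ≤ n / 10) : a ≤ n / 5 := by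
  apply le_of_sq_le_sq _ (by positivity)
  have : b ^ 2 ≤ (n / 10) ^ 2 := by gcongr
  have : c ^ 2 ≤ (n / 10) ^ 2 := by gcongr
  nlinarith [sq_nonneg n]

theorem paradox_lemma (i j : X → X) (hij : Function.Injective (Sum.elim i j)) (u v u' v' : G)
    (huv : ∀ x, i x = u • x ∨ i x = v • x) (huv' : ∀ x, j x = u' • x ∨ j x = v' • x)
    (f : L2 X) (h1 : ‖rho u⁻¹ f - f‖ ≤ ‖f‖ / 10) (h2 : ‖rho v⁻¹ f - f‖ ≤ ‖f‖ / 10)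
    (h3 : ‖rho u'⁻¹ f - f‖ ≤ ‖f‖ / 10) (h4 : ‖rho v'⁻¹ f - f‖ ≤ ‖f‖ / 10) : f = 0 := by
  have hi : Function.Injective i := hij.comp Sum.inl_injective
  have hj : Function.Injective j := hij.comp Sum.inr_injective
  have key : ‖compInj i hi f‖ ^ 2 + ‖compInj j hj f‖ ^ 2 ≤ ‖f‖ ^ 2 := by
    rw [L2_norm_sq, L2_norm_sq, L2_norm_sq]
    have hs := (L2_summable f).comp_injective hij
    have := tsum_comp_le_tsum_of_inj (L2_summable f) (fun x => sq_nonneg _) hij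
    rw [Summable.tsum_sum] at this
    · exact this
    · exact (L2_summable (compInj i hi f))
    · exact (L2_summable (compInj j hj f))
  have a1 := compInj_sub i hi u v huv f
  have a2 := compInj_sub j hj u' v' huv' f
  have n1 : ‖f‖ - ‖compInj i hi f‖ ≤ ‖compInj i hi f - f‖ := by
    rw [norm_sub_rev]; exact norm_sub_norm_le _ _
  have n2 : ‖f‖ - ‖compInj j hj f‖ ≤ ‖compInj j hj f - f‖ := by
    rw [norm_sub_rev]; exact norm_sub_norm_le _ _
  have b1 : ‖compInj i hi f - f‖ ≤ ‖f‖ / 5 := by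
    exact aux_sq (norm_nonneg _) (norm_nonneg _) (norm_nonneg _) a1 h1 h2
  have b2 : ‖compInj j hj f - f‖ ≤ ‖f‖ / 5 := by
    exact aux_sq (norm_nonneg _) (norm_nonneg _) (norm_nonneg _) a2 h3 h4
  by_contra hf
  have hpos : 0 < ‖f‖ := norm_pos_iff.2 hf
  have c1 : (4 / 5 * ‖f‖) ^ 2 ≤ ‖compInj i hi f‖ ^ 2 := by
    gcongr; linarith
  have c2 : (4 / 5 * ‖f‖) ^ 2 ≤ ‖compInj j hj f‖ ^ 2 := by
    gcongr; linarith
  nlinarith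

/-- uniform convexity -/
theorem convex_lemma {E ι : Type*} [NormedAddCommGroup E] [InnerProductSpace ℝ E]
    (s : Finset ι) (v : ι → E) (R ε : ℝ) (hR : 0 ≤ R) (hε1 : ε ≤ 1)
    (hv : ∀ i ∈ s, ‖v i‖ ≤ R)
    (hs : (1 - ε) * (s.card * R) ≤ ‖∑ i ∈ s, v i‖) (i j : ι) (hi : i ∈ s) (hj : j ∈ s) :
    ‖v i - v j‖ ^ 2 ≤ 4 * ε * (s.card * R) ^ 2 := by
  have h1 : ∑ i ∈ s, ∑ j ∈ s, ‖v i - v j‖ ^ 2 =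
      2 * (s.card * ∑ i ∈ s, ‖v i‖ ^ 2) - 2 * ‖∑ i ∈ s, v i‖ ^ 2 := by
    rw [← real_inner_self_eq_norm_sq (∑ i ∈ s, v i), sum_inner]
    simp_rw [inner_sum, @norm_sub_sq ℝ, Finset.sum_add_distrib, Finset.sum_sub_distrib,
      ← Finset.mul_sum]
    simp [Finset.sum_const, ← Finset.mul_sum]
    ring
  have h2 : ∑ i ∈ s, ‖v i‖ ^ 2 ≤ s.card * R ^ 2 := by
    rw [← nsmul_eq_mul]
    apply Finset.sum_le_card_nsmul
    intro i hi
    have := hv i hi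
    gcongr
  have h3 : ((1 - ε) * (s.card * R)) ^ 2 ≤ ‖∑ i ∈ s, v i‖ ^ 2 := by
    have : 0 ≤ (1 - ε) * (s.card * R) := by
      have : 0 ≤ 1 - ε := by linarith
      positivity
    gcongr
  have h4 : ‖v i - v j‖ ^ 2 ≤ ∑ i ∈ s, ∑ j ∈ s, ‖v i - v j‖ ^ 2 := by
    refine le_trans ?_ (Finset.single_le_sum (f := fun i => ∑ j ∈ s, ‖v i - v j‖ ^ 2)
      (fun _ _ => by positivity) hi)
    exact (Finset.single_le_sum (f := fun j => ‖v i - v j‖ ^ 2)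
      (fun _ _ => by positivity) hj)
  have h5 : (s.card : ℝ) * ∑ i ∈ s, ‖v i‖ ^ 2 ≤ s.card * (s.card * R ^ 2) := by gcongr
  have h6 : 0 ≤ (s.card * R) ^ 2 * ε ^ 2 := by positivity
  nlinarith

end Ana
section Words

variable {α : Type*} {G X : Type*} [Group G] [MulAction G X]

theorem evalWord_nil (η : α → G) : evalWord η [] = 1 := rfl

theorem evalWord_cons (η : α → G) (a : α) (w : List α) :
    evalWord η (a :: w) = η a * evalWord η w := by simp [evalWord]

theorem evalWord_append (η : α → G) (w w' : List α) :
    evalWord η (w ++ w') = evalWord η w * evalWord η w' := by simp [evalWord]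

theorem exists_word {η : α → G} {inv : α → α} (hs : IsSymmetricGen η inv) (g : G) :
    ∃ w, evalWord η w = g ∧ ∃ w', evalWord η w' = g⁻¹ ∧ w'.length = w.length := by
  obtain ⟨-, -, hη, hcl⟩ := hs
  have hg : g ∈ Subgroup.closure (Set.range η) := by rw [hcl]; trivial
  induction hg using Subgroup.closure_induction with
  | mem x hx =>
    obtain ⟨a, rfl⟩ := hx
    exact ⟨[a], by simp [evalWord], [inv a], by simp [evalWord, hη], rfl⟩
  | one => exact ⟨[], by simp [evalWord], [], by simp [evalWord], rfl⟩
  | mul x y _ _ ihx ihy =>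
    obtain ⟨w, h1, w', h2, h3⟩ := ihx
    obtain ⟨v, k1, v', k2, k3⟩ := ihy
    exact ⟨w ++ v, by rw [evalWord_append, h1, k1], v' ++ w',
      by rw [evalWord_append, h2, k2, mul_inv_rev], by simp [h3, k3, add_comm]⟩
  | inv x _ ih =>
    obtain ⟨w, h1, w', h2, h3⟩ := ih
    exact ⟨w', h2, w, by rw [h1, inv_inv], h3.symm⟩

theorem even_word {η : α → G} {inv : α → α} (hη : ∀ a, η (inv a) = (η a)⁻¹) (Z : L2 X) (D : ℝ)
    (hD : ∀ c d, ‖rho (η c) Z - rho (η d) Z‖ ≤ D) :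
    ∀ (n : ℕ) (w : List α), w.length = n + n → ‖rho (evalWord η w) Z - Z‖ ≤ n * D := by
  intro n
  induction n with
  | zero =>
    intro w hw
    have : w = [] := List.length_eq_zero_iff.1 (by omega)
    subst this
    simp [evalWord]
  | succ n ih =>
    intro w hw
    match w, hw with
    | [], hw => simp at hw
    | [_], hw => simp at hw; omega
    | a :: b :: w, hw =>
      have hw' : w.length = n + n := by simp at hw; omega
      have h1 := ih w hw'
      have h2 : ‖rho (η a) (rho (η b) Z) - Z‖ ≤ D := by
        have h3 := hD b (inv a)
        rw [← norm_rho_sub (η a), hη, ← rho_mul (η a) (η a)⁻¹, mul_inv_cancel, rho_one] at h3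
        exact h3
      have h4 : ‖rho (η a) (rho (η b) (rho (evalWord η w) Z)) - rho (η a) (rho (η b) Z)‖
          ≤ n * D := by
        rw [norm_rho_sub, norm_rho_sub]; exact h1
      rw [evalWord_cons, evalWord_cons, rho_mul, rho_mul]
      calc _ ≤ _ := norm_sub_le_norm_sub_add_norm_sub _ (rho (η a) (rho (η b) Z)) _
        _ ≤ n * D + D := add_le_add h4 h2
        _ = _ := by push_cast; ring

/-- gap property from a paradoxical decomposition by even elements -/
theorem gap {η : α → G} {inv : α → α} (hs : IsSymmetricGen η inv) (c0 : α)
    (i j : X → X) (hij : Function.Injective (Sum.elim i j)) (s h s' h' : G)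
    (huv : ∀ x, i x = (s * s) • x ∨ i x = (s * h * s⁻¹ * h) • x)
    (huv' : ∀ x, j x = (s' * s') • x ∨ j x = (s' * h' * s'⁻¹ * h') • x) :
    ∃ L : ℝ, 0 ≤ L ∧ ∀ (Z : L2 X) (D : ℝ), (∀ c d, ‖rho (η c) Z - rho (η d) Z‖ ≤ D) →
      ‖Z‖ ≤ L * D := by
  have key1 : ∀ s : G, ∃ L : ℝ, 0 ≤ L ∧ ∀ (Z : L2 X) (D : ℝ),
      (∀ c d, ‖rho (η c) Z - rho (η d) Z‖ ≤ D) → ‖rho (s * s)⁻¹ Z - Z‖ ≤ L * D := by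
    intro s
    obtain ⟨w, h1, -⟩ := exists_word hs s
    refine ⟨w.length, by positivity, fun Z D hD => ?_⟩
    have := even_word hs.2.2.1 Z D hD w.length (w ++ w) (by simp)
    rw [evalWord_append, h1] at this
    rwa [← norm_rho_sub (s * s), ← rho_mul, mul_inv_cancel, rho_one, norm_sub_rev]
  have key2 : ∀ s h : G, ∃ L : ℝ, 0 ≤ L ∧ ∀ (Z : L2 X) (D : ℝ),
      (∀ c d, ‖rho (η c) Z - rho (η d) Z‖ ≤ D) →
        ‖rho (s * h * s⁻¹ * h)⁻¹ Z - Z‖ ≤ L * D := by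
    intro s h
    obtain ⟨w, h1, w', h2, h3⟩ := exists_word hs s
    obtain ⟨v, h4, -⟩ := exists_word hs h
    refine ⟨(w.length + v.length : ℕ), by positivity, fun Z D hD => ?_⟩
    have := even_word hs.2.2.1 Z D hD (w.length + v.length) (w ++ v ++ w' ++ v)
      (by simp [h3]; omega)
    rw [evalWord_append, evalWord_append, evalWord_append, h1, h2, h4] at this
    rwa [← norm_rho_sub (s * h * s⁻¹ * h), ← rho_mul, mul_inv_cancel, rho_one, norm_sub_rev]
  obtain ⟨L1, p1, k1⟩ := key1 s
  obtain ⟨L2, p2, k2⟩ := key2 s h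
  obtain ⟨L3, p3, k3⟩ := key1 s'
  obtain ⟨L4, p4, k4⟩ := key2 s' h'
  refine ⟨10 * (L1 + L2 + L3 + L4), by positivity, fun Z D hD => ?_⟩
  have hD0 : 0 ≤ D := (norm_nonneg _).trans (hD c0 c0)
  by_contra hlt
  push Not at hlt
  have q1 := mul_nonneg p1 hD0
  have q2 := mul_nonneg p2 hD0
  have q3 := mul_nonneg p3 hD0
  have q4 := mul_nonneg p4 hD0
  have := paradox_lemma i j hij _ _ _ _ huv huv' Z
    ((k1 Z D hD).trans (by linarith)) ((k2 Z D hD).trans (by linarith))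
    ((k3 Z D hD).trans (by linarith)) ((k4 Z D hD).trans (by linarith))
  rw [this, norm_zero] at hlt
  linarith

variable [Fintype α] [DecidableEq α]

/-- letters allowed after `d` -/
def nxt (inv : α → α) (d : α) : Finset α := Finset.univ.erase (inv d)

theorem mem_nxt (inv : α → α) (d a : α) : a ∈ nxt inv d ↔ a ≠ inv d := by simp [nxt]

theorem card_nxt (inv : α → α) (d : α) : (nxt inv d).card = Fintype.card α - 1 := by
  simp [nxt, Finset.card_erase_of_mem]

/-- non-backtracking operator -/
noncomputable def stepT (η : α → G) (inv : α → α) (F : α → L2 X) (d : α) : L2 X :=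
  ∑ a ∈ nxt inv d, rho (η a) (F a)

theorem avoid3 (h4 : 4 ≤ Fintype.card α) (x y z : α) : ∃ v, v ≠ x ∧ v ≠ y ∧ v ≠ z := by
  by_contra hc
  push Not at hc
  have : (Finset.univ : Finset α) ⊆ {x, y, z} := by
    intro v _
    by_cases h1 : v = x
    · simp [h1]
    by_cases h2 : v = y
    · simp [h2]
    simp [hc v h1 h2]
  have h5 := Finset.card_le_card this
  have h6 := Finset.card_le_three (a := x) (b := y) (c := z)
  rw [Finset.card_univ] at h5
  omega

theorem contraction {η : α → G} {inv : α → α} (hs : IsSymmetricGen η inv)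
    (h4 : 4 ≤ Fintype.card α) (L : ℝ) (hL0 : 0 ≤ L)
    (hL : ∀ (Z : L2 X) (D : ℝ), (∀ c d, ‖rho (η c) Z - rho (η d) Z‖ ≤ D) → ‖Z‖ ≤ L * D) :
    ∃ κ : ℝ, 0 < κ ∧ κ < 1 ∧ ∀ (F : α → L2 X) (R : ℝ), (∀ d, ‖F d‖ ≤ R) → ∀ e,
      ‖stepT η inv (stepT η inv (stepT η inv F)) e‖ ≤
        κ * (((Fintype.card α - 1 : ℕ) : ℝ) ^ 3 * R) := by
  obtain ⟨q, hq⟩ : ∃ q, q = Fintype.card α - 1 := ⟨_, rfl⟩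
  have hinvinv := hs.1
  have swap : ∀ a b, a ≠ inv b → b ≠ inv a := by
    rintro a b hab rfl; exact hab (hinvinv a).symm
  set M : ℝ := (q : ℝ) ^ 3 with hM
  have hM1 : 1 ≤ M := by
    apply one_le_pow₀
    have : 1 ≤ q := by omega
    exact_mod_cast this
  have hden : 0 < 1 + M + 6 * L * M := by positivity
  set ζ : ℝ := 1 / (1 + M + 6 * L * M) with hζ
  have hζ0 : 0 < ζ := by positivity
  have hζ1 : ζ < 1 := by
    rw [hζ, div_lt_one hden]
    nlinarith [mul_nonneg hL0 (by linarith : 0 ≤ M)]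
  have hζM : ζ * (M + 6 * L * M) < 1 := by
    rw [hζ, one_div, inv_mul_lt_iff₀ hden]; linarith
  refine ⟨1 - ζ ^ 2, by nlinarith, by nlinarith, fun F R hF e => ?_⟩
  rw [← hq, ← hM]
  have hR : 0 ≤ R := (norm_nonneg _).trans (hF e)
  rcases hR.eq_or_lt with hR0 | hRpos
  · have hF0 : F = 0 := by
      funext d; have := hF d; rw [← hR0] at this; simpa using this
    simp [stepT, hF0, ← hR0]
  by_contra hlt
  push Not at hlt
  let s : Finset (Σ _ : α, Σ _ : α, α) :=
    (nxt inv e).sigma fun v => (nxt inv v).sigma fun c => nxt inv c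
  let V : (Σ _ : α, Σ _ : α, α) → L2 X := fun x =>
    rho (η x.1) (rho (η x.2.1) (rho (η x.2.2) (F x.2.2)))
  have hsum : stepT η inv (stepT η inv (stepT η inv F)) e = ∑ x ∈ s, V x := by
    simp only [stepT, s, V, Finset.sum_sigma, map_sum]
  have hcard : (s.card : ℝ) = M := by
    have : s.card = q ^ 3 := by
      simp only [s, Finset.card_sigma, card_nxt, Finset.sum_const, smul_eq_mul, ← hq]
      ring
    rw [this, hM]; push_cast; rfl
  rw [hsum] at hlt
  have hV : ∀ x ∈ s, ‖V x‖ ≤ R := by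
    intro x _
    simp only [V, norm_rho]; exact hF _
  have hmem : ∀ v c a, v ≠ inv e → c ≠ inv v → a ≠ inv c →
      (⟨v, c, a⟩ : Σ _ : α, Σ _ : α, α) ∈ s := by
    intro v c a h1 h2 h3
    simp only [s, Finset.mem_sigma, mem_nxt]
    exact ⟨h1, h2, h3⟩
  have hclose : ∀ x ∈ s, ∀ y ∈ s, ‖V x - V y‖ ≤ 2 * ζ * (M * R) := by
    intro x hx y hy
    have := convex_lemma s V R (ζ ^ 2) hR (by nlinarith) hV
      (by rw [hcard]; exact hlt.le) x y hx hy
    rw [hcard] at this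
    apply le_of_sq_le_sq _ (by positivity)
    linarith
  set δ := 2 * ζ * (M * R) with hδ
  have hnorm : ∀ x ∈ s, R * (1 - ζ ^ 2 * M) ≤ ‖V x‖ := by
    intro x hx
    have h1 : ‖∑ x ∈ s, V x‖ ≤ ∑ x ∈ s, ‖V x‖ := norm_sum_le _ _
    have h2 : ∑ y ∈ s, ‖V y‖ = ‖V x‖ + ∑ y ∈ s.erase x, ‖V y‖ :=
      (Finset.add_sum_erase s (fun y => ‖V y‖) hx).symm
    have h3 : ∑ y ∈ s.erase x, ‖V y‖ ≤ (s.erase x).card • R :=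
      Finset.sum_le_card_nsmul _ _ _ (fun y hy => hV y (Finset.mem_of_mem_erase hy))
    have h5 : ((s.erase x).card : ℝ) = M - 1 := by
      rw [Finset.card_erase_of_mem hx, Nat.cast_sub (Finset.card_pos.2 ⟨x, hx⟩), hcard]; simp
    rw [nsmul_eq_mul, h5] at h3
    nlinarith
  have hab : ∀ a b, ‖rho (η a) (F a) - rho (η b) (F b)‖ ≤ δ := by
    intro a b
    obtain ⟨c, hc1, hc2, -⟩ := avoid3 h4 (inv a) (inv b) (inv b)
    obtain ⟨v, hv1, hv2, -⟩ := avoid3 h4 (inv e) (inv c) (inv c)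
    have := hclose _ (hmem v c a hv1 (swap _ _ hv2) (swap _ _ hc1))
      _ (hmem v c b hv1 (swap _ _ hv2) (swap _ _ hc2))
    simpa only [V, norm_rho_sub] using this
  have hcd : ∀ c d, ‖rho (η c) (rho (η e) (F e)) - rho (η d) (rho (η e) (F e))‖ ≤ 3 * δ := by
    intro c d
    obtain ⟨a, ha1, ha2, -⟩ := avoid3 h4 (inv c) (inv d) (inv d)
    obtain ⟨v, hv1, hv2, hv3⟩ := avoid3 h4 (inv e) (inv c) (inv d)
    have h1 := hclose _ (hmem v c a hv1 (swap _ _ hv2) ha1)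
      _ (hmem v d a hv1 (swap _ _ hv3) ha2)
    simp only [V, norm_rho_sub] at h1
    have h2 := hab e a
    have h3 := hab a e
    rw [← norm_rho_sub (η c)] at h2
    rw [← norm_rho_sub (η d)] at h3
    calc _ ≤ _ := norm_sub_le_norm_sub_add_norm_sub _ (rho (η c) (rho (η a) (F a))) _
      _ ≤ δ + (δ + δ) := by
        refine add_le_add h2 ((norm_sub_le_norm_sub_add_norm_sub _
          (rho (η d) (rho (η a) (F a))) _).trans (add_le_add h1 h3))
      _ = 3 * δ := by ring
  have hZ := hL _ _ hcd
  obtain ⟨c, hc1, -, -⟩ := avoid3 h4 (inv e) (inv e) (inv e)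
  obtain ⟨v, hv1, hv2, -⟩ := avoid3 h4 (inv e) (inv c) (inv c)
  have hn := hnorm _ (hmem v c e hv1 (swap _ _ hv2) (swap _ _ hc1))
  simp only [V, norm_rho] at hn hZ
  have hfin : R * (1 - ζ ^ 2 * M) ≤ R * (ζ * (6 * L * M)) := by
    refine hn.trans (hZ.trans (le_of_eq ?_))
    rw [hδ]; ring
  have hfin2 := le_of_mul_le_mul_left hfin hRpos
  nlinarith [mul_nonneg hζ0.le (by linarith : 0 ≤ M)]

/-- words of length `n` that are reduced after the letter `d` -/
def WW (inv : α → α) : ℕ → α → Finset (List α)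
  | 0, _ => {[]}
  | n + 1, d => (nxt inv d).biUnion fun a => (WW inv n a).image (List.cons a)

theorem mem_WW (inv : α → α) (n : ℕ) (d : α) (w : List α) :
    w ∈ WW inv n d ↔ w.length = n ∧ Reduced inv (d :: w) := by
  induction n generalizing d w with
  | zero =>
    simp only [WW, Finset.mem_singleton, List.length_eq_zero_iff, Reduced]
    constructor
    · rintro rfl; exact ⟨rfl, List.isChain_singleton d⟩
    · exact fun h => h.1
  | succ n ih =>
    simp only [WW, Finset.mem_biUnion, Finset.mem_image, mem_nxt]
    constructor
    · rintro ⟨a, ha, v, hv, rfl⟩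
      rw [ih] at hv
      refine ⟨by simp [hv.1], ?_⟩
      simp only [Reduced] at hv ⊢
      exact List.isChain_cons_cons.2 ⟨ha, hv.2⟩
    · rintro ⟨h1, h2⟩
      cases w with
      | nil => simp at h1
      | cons a v =>
        have := List.isChain_cons_cons.1 h2
        exact ⟨a, this.1, v, (ih a v).2 ⟨by simpa using h1, this.2⟩, rfl⟩

theorem WW_disj (inv : α → α) (n : ℕ) (d : α) :
    Set.PairwiseDisjoint (↑(nxt inv d)) fun a => (WW inv n a).image (List.cons a) := by
  intro a _ b _ hab
  simp only [Function.onFun]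
  rw [Finset.disjoint_left]
  intro w h1 h2
  obtain ⟨v, -, rfl⟩ := Finset.mem_image.1 h1
  obtain ⟨v', -, h⟩ := Finset.mem_image.1 h2
  simp at h
  exact hab h.1.symm

theorem card_WW (inv : α → α) (n : ℕ) (d : α) :
    (WW inv n d).card = (Fintype.card α - 1) ^ n := by
  induction n generalizing d with
  | zero => simp [WW]
  | succ n ih =>
    rw [WW, Finset.card_biUnion (WW_disj inv n d)]
    simp_rw [Finset.card_image_of_injective _ (List.cons_injective), ih]
    simp [card_nxt, pow_succ, mul_comm]

theorem sum_WW (η : α → G) (inv : α → α) (f : L2 X) (n : ℕ) (d : α) :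
    ∑ w ∈ WW inv n d, rho (evalWord η w) f = (stepT η inv)^[n] (fun _ => f) d := by
  induction n generalizing d with
  | zero => simp [WW, evalWord]
  | succ n ih =>
    rw [WW, Finset.sum_biUnion (WW_disj inv n d), Function.iterate_succ_apply', stepT]
    refine Finset.sum_congr rfl fun a _ => ?_
    rw [Finset.sum_image (fun _ _ _ _ h => List.cons_injective h), ← ih, map_sum]
    refine Finset.sum_congr rfl fun w _ => ?_
    rw [evalWord_cons, rho_mul]

theorem decay {η : α → G} {inv : α → α} (hs : IsSymmetricGen η inv)
    (h4 : 4 ≤ Fintype.card α) (L : ℝ) (hL0 : 0 ≤ L)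
    (hL : ∀ (Z : L2 X) (D : ℝ), (∀ c d, ‖rho (η c) Z - rho (η d) Z‖ ≤ D) → ‖Z‖ ≤ L * D) :
    ∃ C r : ℝ, 0 < C ∧ 0 < r ∧ r < 1 ∧ ∀ (n : ℕ) (f : L2 X), ‖f‖ ≤ 1 → ∀ d,
      ‖∑ w ∈ WW inv n d, rho (evalWord η w) f‖ ≤
        C * r ^ n * ((Fintype.card α - 1 : ℕ) : ℝ) ^ n := by
  obtain ⟨κ, hκ0, hκ1, hκ⟩ := contraction hs h4 L hL0 hL
  set q : ℝ := ((Fintype.card α - 1 : ℕ) : ℝ) with hq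
  set r : ℝ := 1 - (1 - κ) / 3 with hr
  have hr0 : 0 < r := by rw [hr]; linarith
  have hr1 : r < 1 := by rw [hr]; linarith
  have hrκ : κ ≤ r ^ 3 := by
    have hx : 0 < (1 - κ) / 3 := by linarith
    have hk : κ = 1 - 3 * ((1 - κ) / 3) := by ring
    rw [hr]
    generalize (1 - κ) / 3 = x at *
    nlinarith [mul_pos hx hx]
  have hq0 : 0 ≤ q := by positivity
  refine ⟨(r ^ 2)⁻¹, r, by positivity, hr0, hr1, fun n f hf => ?_⟩
  simp_rw [sum_WW]
  have hone : ∀ (F : α → L2 X) (R : ℝ), (∀ d, ‖F d‖ ≤ R) → ∀ e, ‖stepT η inv F e‖ ≤ q * R := by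
    intro F R hF e
    rw [stepT]
    refine (norm_sum_le _ _).trans ?_
    refine (Finset.sum_le_card_nsmul _ _ R (fun a _ => by rw [norm_rho]; exact hF a)).trans ?_
    rw [card_nxt, nsmul_eq_mul]
  have hC : ∀ m ≤ 2, 1 ≤ (r ^ 2)⁻¹ * r ^ m := by
    intro m hm
    rw [← div_eq_inv_mul, one_le_div (by positivity)]
    exact pow_le_pow_of_le_one hr0.le hr1.le hm
  have b0 : ∀ d, ‖(stepT η inv)^[0] (fun _ => f) d‖ ≤ 1 := fun d => by simpa using hf
  have b1 : ∀ d, ‖(stepT η inv)^[1] (fun _ => f) d‖ ≤ q * 1 := fun d => hone _ _ b0 d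
  have b2 : ∀ d, ‖(stepT η inv)^[2] (fun _ => f) d‖ ≤ q * (q * 1) := fun d => hone _ _ b1 d
  induction n using Nat.strong_induction_on with
  | _ n ih =>
    match n with
    | 0 => intro d; refine (b0 d).trans ?_; simpa using hC 0 (by norm_num)
    | 1 =>
      intro d; refine (b1 d).trans ?_
      have := mul_le_mul_of_nonneg_right (hC 1 (by norm_num)) hq0
      simpa using this
    | 2 =>
      intro d; refine (b2 d).trans ?_
      have := mul_le_mul_of_nonneg_right (hC 2 (by norm_num)) (pow_nonneg hq0 2)
      linarith
    | m + 3 =>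
      intro d
      have h1 := ih m (by omega)
      rw [Function.iterate_succ_apply', Function.iterate_succ_apply',
        Function.iterate_succ_apply']
      refine (hκ _ _ h1 d).trans ?_
      calc κ * (q ^ 3 * ((r ^ 2)⁻¹ * r ^ m * q ^ m))
          ≤ r ^ 3 * (q ^ 3 * ((r ^ 2)⁻¹ * r ^ m * q ^ m)) := by gcongr
        _ = _ := by ring

open Classical in
theorem count_fix {η : α → G} {inv : α → α} (x : X) (n : ℕ) (d : α) :
    (((WW inv n d).filter fun w => evalWord η w • x = x).card : ℝ) ≤
      ‖∑ w ∈ WW inv n d, rho (evalWord η w) (lp.single 2 x (1 : ℝ) : L2 X)‖ := by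
  refine le_trans ?_ (lp.norm_apply_le_norm (by norm_num) _ x)
  refine le_trans ?_ (le_abs_self _)
  rw [lp.coeFn_sum, Finset.sum_apply, Finset.card_filter]
  push_cast
  refine Finset.sum_le_sum fun w _ => ?_
  rw [rho_apply]
  split_ifs with h
  · rw [inv_smul_eq_iff.2 h.symm]
    simp
  · have : (evalWord η w)⁻¹ • x ≠ x := fun h' => h (inv_smul_eq_iff.1 h').symm
    simp [this]

theorem count_le {η : α → G} {inv : α → α} (n : ℕ) (b : ℝ)
    (hdec : ∀ (f : L2 X), ‖f‖ ≤ 1 → ∀ d, ‖∑ w ∈ WW inv n d, rho (evalWord η w) f‖ ≤ b)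
    (x : X) (d : α) [DecidablePred fun w : List α => evalWord η w • x = x] :
    (((WW inv n d).filter fun w => evalWord η w • x = x).card : ℝ) ≤ b := by
  classical
  have h1 := count_fix (η := η) (inv := inv) x n d
  have h2 := hdec (lp.single 2 x (1 : ℝ)) (by rw [lp.norm_single (by norm_num)]; simp) d
  refine le_trans (le_of_eq ?_) (h1.trans (le_trans (le_of_eq ?_) h2))
  · congr!
  · congr!

theorem cyc_count {inv : α → α} (h1 : ∀ a, inv (inv a) = a) (h2 : ∀ a, inv a ≠ a)
    (h4 : 4 ≤ Fintype.card α) (n : ℕ) :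
    (Fintype.card α - 1) ^ n ≤
      (Fintype.card α - 1) * wordCount {w : List α | CyclicallyReduced inv w} n := by
  have hfin : ∀ n : ℕ, {w : List α | CyclicallyReduced inv w ∧ w.length = n}.Finite := fun n =>
    (List.finite_length_eq α n).subset fun w hw => hw.2
  have hwc : ∀ n, wordCount {w : List α | CyclicallyReduced inv w} n =
      {w : List α | CyclicallyReduced inv w ∧ w.length = n}.ncard := fun n => rfl
  rw [hwc]
  cases n with
  | zero =>
    have : 0 < {w : List α | CyclicallyReduced inv w ∧ w.length = 0}.ncard := by
      rw [Set.ncard_pos (hfin 0)]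
      exact ⟨[], List.isChain_nil, rfl⟩
    simp only [pow_zero]
    exact Nat.mul_pos (by omega) this
  | succ n =>
    rw [pow_succ, mul_comm]
    apply Nat.mul_le_mul_left
    obtain ⟨d⟩ : Nonempty α := Fintype.card_pos_iff.1 (by omega)
    rw [← card_WW inv n d, ← Set.ncard_coe_finset]
    have hex : ∀ w : List α, ∃ x, (∀ b ∈ w.getLast?, x ≠ inv b) ∧ (∀ b ∈ w.head?, x ≠ inv b) := by
      intro w
      obtain ⟨x, hx1, hx2, -⟩ := avoid3 h4 (inv (w.getLast?.getD d)) (inv (w.head?.getD d)) d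
      refine ⟨x, ?_, ?_⟩
      · intro b hb
        rw [Option.mem_def] at hb; rw [hb] at hx1; simpa using hx1
      · intro b hb
        rw [Option.mem_def] at hb; rw [hb] at hx2; simpa using hx2
    choose x hx1 hx2 using hex
    refine Set.ncard_le_ncard_of_injOn (fun w => w ++ [x w]) ?_ ?_ (hfin _)
    · intro w hw
      have hw := (mem_WW inv n d w).1 hw
      have hred : List.IsChain (fun a b => b ≠ inv a) w := by
        have := hw.2
        simp only [Reduced] at this
        exact (List.isChain_cons.1 this).2
      have hred2 : List.IsChain (fun a b => b ≠ inv a) (w ++ [x w]) := by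
        rw [List.isChain_append]
        refine ⟨hred, by simp, ?_⟩
        intro a ha b hb
        simp at hb
        subst hb
        exact hx1 w a ha
      refine ⟨?_, by simp [hw.1]⟩
      simp only [CyclicallyReduced, Reduced]
      show List.IsChain _ _
      rw [List.isChain_append]
      refine ⟨hred2, hred2, ?_⟩
      intro a ha b hb
      simp at ha
      subst ha
      cases w with
      | nil =>
        simp at hb; subst hb
        exact (h2 _).symm
      | cons c w =>
        simp at hb; subst hb
        intro hc
        apply hx2 (c :: w) c (by simp)
        exact ((congrArg inv hc).trans (h1 _)).symm
    · intro w _ w' _ h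
      exact (List.append_inj' h rfl).1

end Words
section Final
open HNNExtension HNNExtension.NormalWord

theorem prefix_flatMap {α G : Type*} [Group G] (η : α → G) (zs : α → List G)
    (hzs : ∀ a, (zs a).prod = η a) (w : List α) (z' : List G) (hz : z' <+: w.flatMap zs) :
    ∃ i ≤ w.length, ∃ p : List G, (p = [] ∨ ∃ s, p <+: zs s) ∧
      z'.prod = evalWord η (w.take i) * p.prod := by
  induction w generalizing z' with
  | nil =>
    simp at hz
    exact ⟨0, le_rfl, [], Or.inl rfl, by simp [hz, evalWord]⟩
  | cons a w ih =>
    rw [List.flatMap_cons] at hz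
    obtain ⟨r, hr⟩ := hz
    rcases List.append_eq_append_iff.1 hr with ⟨b, h1, h2⟩ | ⟨b, h1, h2⟩
    · exact ⟨0, Nat.zero_le _, z', Or.inr ⟨a, ⟨b, h1.symm⟩⟩, by simp [evalWord]⟩
    · obtain ⟨i, hi, p, hp, he⟩ := ih b ⟨r, h2.symm⟩
      refine ⟨i + 1, by simpa using hi, p, hp, ?_⟩
      rw [h1, List.prod_append, he, hzs, List.take_succ_cons, evalWord_cons, mul_assoc]

variable {H : Type*} [Group H] {A B : Subgroup H} (φ : A ≃* B)

theorem exists_syl (g : HNNExtension H A B φ) :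
    ∃ z : List (HNNExtension H A B φ), (∀ s ∈ z, s ∈ Syl φ) ∧ z.prod = g := by
  obtain ⟨⟨k, l, hl⟩, rfl⟩ := exists_red φ g
  refine ⟨of k :: l.flatMap (fun x => [t ^ (x.1 : ℤ), of x.2]), ?_, ?_⟩
  · intro s hs
    rw [List.mem_cons] at hs
    rcases hs with rfl | hs
    · exact Or.inl ⟨k, rfl⟩
    · rw [List.mem_flatMap] at hs
      obtain ⟨x, -, hx⟩ := hs
      simp at hx
      rcases hx with rfl | rfl
      · exact Or.inr ⟨_, rfl⟩
      · exact Or.inl ⟨_, rfl⟩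
  · simp only [ReducedWord.prod, List.prod_cons]
    congr 1
    clear hl
    induction l with
    | nil => simp
    | cons x l ih => simp [ih, mul_assoc]

theorem elliptic_rotate {α : Type*} (η : α → HNNExtension H A B φ)
    (zs : α → List (HNNExtension H A B φ)) (hzs : ∀ a, (zs a).prod = η a)
    (hsyl : ∀ a, ∀ s ∈ zs a, s ∈ Syl φ) (w : List α)
    (hell : IsElliptic ((of : H →* HNNExtension H A B φ).range : Set _) (evalWord η w)) :
    ∃ i ≤ w.length, ∃ p : List (HNNExtension H A B φ), (p = [] ∨ ∃ s, p <+: zs s) ∧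
      evalWord η (w.rotate i) • (QuotientGroup.mk p.prod : XX φ) = QuotientGroup.mk p.prod := by
  have hprod : (w.flatMap zs).prod = evalWord η w := by
    clear hell
    induction w with
    | nil => rfl
    | cons a w ih => rw [List.flatMap_cons, List.prod_append, ih, hzs, evalWord_cons]
  obtain ⟨h, ⟨k, rfl⟩, hc⟩ := hell
  obtain ⟨c, hc⟩ := isConj_iff.1 hc
  obtain ⟨z', hz', ⟨m, hm⟩⟩ := elliptic_path φ (w.flatMap zs)
    (by
      intro s hs
      obtain ⟨a, -, ha⟩ := List.mem_flatMap.1 hs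
      exact hsyl a s ha)
    ⟨c⁻¹, k, by rw [hprod, ← hc]; simp⟩
  obtain ⟨i, hi, p, hp, he⟩ := prefix_flatMap η zs hzs w z' hz'
  refine ⟨i, hi, p, hp, ?_⟩
  rw [hprod, he] at hm
  rw [List.rotate_eq_drop_append_take hi, evalWord_append]
  have hw : evalWord η w = evalWord η (w.take i) * evalWord η (w.drop i) := by
    rw [← evalWord_append, List.take_append_drop]
  rw [hw] at hm
  symm
  change (QuotientGroup.mk p.prod : XX φ) = QuotientGroup.mk (_ * p.prod)
  rw [QuotientGroup.eq]
  refine ⟨m, ?_⟩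
  rw [hm]
  group

theorem exists_notMem {H : Type*} [Group H] (A : Subgroup H) (hA : 2 ≤ Cardinal.mk (H ⧸ A)) :
    ∃ h, h ∉ A := by
  by_contra hc
  push Not at hc
  have : Subsingleton (H ⧸ A) := by
    constructor
    intro x y
    induction x using QuotientGroup.induction_on with
    | H x =>
      induction y using QuotientGroup.induction_on with
      | H y => exact QuotientGroup.eq.2 (hc _)
  have h1 := Cardinal.mk_le_one_iff_set_subsingleton (s := (Set.univ : Set (H ⧸ A)))
  have h2 : Cardinal.mk (H ⧸ A) ≤ 1 := Cardinal.le_one_iff_subsingleton.2 this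
  have h3 := hA.trans h2
  norm_num at h3

theorem card_four {α : Type*} [Fintype α] {G : Type*} [Group G] (η : α → G) (inv : α → α)
    (hs : IsSymmetricGen η inv) (x y : G) (hxy : x * y ≠ y * x) : 4 ≤ Fintype.card α := by
  classical
  by_contra hlt
  apply hxy
  obtain ⟨h1, h2, h3, h4⟩ := hs
  have hcomm : ∀ a b, η a * η b = η b * η a := by
    intro a b
    by_cases hab : b = a
    · rw [hab]
    by_cases hab' : b = inv a
    · rw [hab', h3]; simp
    exfalso
    apply hlt
    have h5 : inv b ≠ a := by rintro rfl; exact hab' (h1 b).symm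
    have h6 : inv b ≠ inv a := by
      intro h; apply hab; rw [← h1 b, h, h1]
    have : ({a, inv a, b, inv b} : Finset α).card = 4 := by
      rw [Finset.card_insert_of_notMem, Finset.card_insert_of_notMem,
        Finset.card_insert_of_notMem, Finset.card_singleton]
      · simpa using (h2 b).symm
      · simp only [Finset.mem_insert, Finset.mem_singleton, not_or]
        exact ⟨fun h => hab' h.symm, fun h => h6 h.symm⟩
      · simp only [Finset.mem_insert, Finset.mem_singleton, not_or]
        exact ⟨(h2 a).symm, fun h => hab h.symm, fun h => h5 h.symm⟩
    rw [← this]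
    exact Finset.card_le_univ _
  have hxm : ∀ g : G, g ∈ Subgroup.closure (Set.range η) := fun g => by rw [h4]; trivial
  have c1 : Set.range η ⊆ (Subgroup.centralizer (Set.range η) : Set G) := by
    rintro _ ⟨a, rfl⟩
    rw [SetLike.mem_coe, Subgroup.mem_centralizer_iff]
    rintro _ ⟨b, rfl⟩
    exact hcomm b a
  have c2 := (Subgroup.closure_le _).2 c1
  have c3 : Set.range η ⊆ (Subgroup.centralizer {x} : Set G) := by
    rintro _ ⟨a, rfl⟩
    rw [SetLike.mem_coe, Subgroup.mem_centralizer_iff]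
    intro g hg
    rw [Set.mem_singleton_iff.1 hg]
    exact (Subgroup.mem_centralizer_iff.1 (c2 (hxm x)) (η a) ⟨a, rfl⟩).symm
  have c4 := (Subgroup.closure_le _).2 c3
  exact Subgroup.mem_centralizer_iff.1 (c4 (hxm y)) x rfl

theorem ell_count {α : Type*} [Fintype α] [DecidableEq α] (η : α → HNNExtension H A B φ)
    (inv : α → α) (hinv : ∀ a, inv (inv a) = a) (h4 : 4 ≤ Fintype.card α) (C r : ℝ)
    (hdec : ∀ (n : ℕ) (f : L2 (XX φ)), ‖f‖ ≤ 1 → ∀ d,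
      ‖∑ w ∈ WW inv n d, rho (evalWord η w) f‖ ≤
        C * r ^ n * ((Fintype.card α - 1 : ℕ) : ℝ) ^ n) :
    ∃ K : ℕ, ∀ n : ℕ,
      (wordCount {w : List α | CyclicallyReduced inv w ∧
          IsElliptic ((of : H →* HNNExtension H A B φ).range : Set _)
            (evalWord η w)} n : ℝ) ≤
      (n + 1 : ℕ) * (K * (C * r ^ n * ((Fintype.card α - 1 : ℕ) : ℝ) ^ n)) := by
  classical
  choose zs hsyl hzs using fun a => exists_syl φ (η a)
  let Q : Finset (HNNExtension H A B φ) :=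
    insert 1 (Finset.univ.biUnion fun s => ((zs s).inits.map List.prod).toFinset)
  refine ⟨Q.card * Fintype.card α, fun n => ?_⟩
  let V : HNNExtension H A B φ → α → Finset (List α) := fun p d =>
    (WW inv n d).filter fun w => evalWord η w • (QuotientGroup.mk p : XX φ) = QuotientGroup.mk p
  let U : Finset (List α) := (Finset.range (n + 1)).biUnion fun i =>
    (Q ×ˢ (Finset.univ : Finset α)).biUnion fun x =>
      (V x.1 x.2).image (fun v => v.rotate (n - i))
  have hsub : {w : List α | (CyclicallyReduced inv w ∧
          IsElliptic ((of : H →* HNNExtension H A B φ).range : Set _)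
            (evalWord η w)) ∧ w.length = n} ⊆ ↑U := by
    rintro w ⟨⟨hcyc, hell⟩, hlen⟩
    obtain ⟨i, hi, p, hp, hfix⟩ := elliptic_rotate φ η zs hzs hsyl w hell
    have hred : List.IsChain (fun a b => b ≠ inv a) (w.rotate i) := by
      have h0 : List.IsChain (fun a b => b ≠ inv a) (w ++ w) := hcyc
      refine h0.infix ?_
      rw [List.rotate_eq_drop_append_take hi]
      refine ⟨w.take i, w.drop i, ?_⟩
      simp only [List.append_assoc, List.take_append_drop]
      rw [← List.append_assoc, List.take_append_drop]
    obtain ⟨d, hd⟩ : ∃ d, w.rotate i ∈ WW inv n d := by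
      obtain ⟨a0⟩ : Nonempty α := Fintype.card_pos_iff.1 (by omega)
      cases hw : w.rotate i with
      | nil =>
        refine ⟨a0, (mem_WW inv n a0 _).2 ⟨?_, List.isChain_singleton _⟩⟩
        rw [← hw, List.length_rotate, hlen]
      | cons b v =>
        have : ∃ d, b ≠ inv d := by
          obtain ⟨x, hx, -⟩ := avoid3 h4 (inv b) b b
          refine ⟨x, ?_⟩
          rintro rfl
          exact hx (hinv x).symm
        obtain ⟨d, hd⟩ := this
        refine ⟨d, (mem_WW inv n d _).2 ⟨?_, ?_⟩⟩
        · rw [← hw, List.length_rotate, hlen]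
        · rw [hw] at hred
          exact List.isChain_cons_cons.2 ⟨hd, hred⟩
    have hpQ : p.prod ∈ Q := by
      simp only [Q, Finset.mem_insert, Finset.mem_biUnion, Finset.mem_univ, true_and,
        List.mem_toFinset, List.mem_map, List.mem_inits]
      rcases hp with rfl | ⟨s, hs⟩
      · left; rfl
      · right; exact ⟨s, p, hs, rfl⟩
    simp only [U, Finset.coe_biUnion, Set.mem_iUnion, Finset.mem_coe, Finset.mem_image]
    refine ⟨i, Finset.mem_range.2 (by omega), (p.prod, d), by simp [hpQ], w.rotate i, ?_, ?_⟩
    · exact Finset.mem_filter.2 ⟨hd, hfix⟩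
    · rw [List.rotate_rotate, show i + (n - i) = w.length by omega, List.rotate_length]
  have hcard : wordCount {w : List α | CyclicallyReduced inv w ∧
          IsElliptic ((of : H →* HNNExtension H A B φ).range : Set _)
            (evalWord η w)} n ≤ U.card := by
    have := Set.ncard_le_ncard hsub U.finite_toSet
    rwa [Set.ncard_coe_finset] at this
  have hV : ∀ p d, ((V p d).card : ℝ) ≤ C * r ^ n * ((Fintype.card α - 1 : ℕ) : ℝ) ^ n := by
    intro p d
    exact count_le n _ (hdec n) _ d
  have hU : U.card ≤ ∑ i ∈ Finset.range (n + 1), ∑ x ∈ Q ×ˢ (Finset.univ : Finset α),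
      (V x.1 x.2).card := by
    refine Finset.card_biUnion_le.trans (Finset.sum_le_sum fun i _ => ?_)
    refine Finset.card_biUnion_le.trans (Finset.sum_le_sum fun x _ => ?_)
    exact Finset.card_image_le
  clear hsub
  clear_value U V Q
  generalize C * r ^ n * ((Fintype.card α - 1 : ℕ) : ℝ) ^ n = b at hV ⊢
  generalize wordCount {w : List α | CyclicallyReduced inv w ∧
          IsElliptic ((of : H →* HNNExtension H A B φ).range : Set _)
            (evalWord η w)} n = N at hcard ⊢
  have h1 : (N : ℝ) ≤ ((∑ i ∈ Finset.range (n + 1), ∑ x ∈ Q ×ˢ (Finset.univ : Finset α),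
      (V x.1 x.2).card : ℕ) : ℝ) := Nat.cast_le.2 (hcard.trans hU)
  refine h1.trans ?_
  rw [Nat.cast_sum]
  have h2 : ∀ i ∈ Finset.range (n + 1), ((∑ x ∈ Q ×ˢ (Finset.univ : Finset α),
      (V x.1 x.2).card : ℕ) : ℝ) ≤ ((Q.card * Fintype.card α : ℕ) : ℝ) * b := by
    intro i _
    rw [Nat.cast_sum]
    have h3 := Finset.sum_le_card_nsmul (Q ×ˢ (Finset.univ : Finset α))
      (fun x => ((V x.1 x.2).card : ℝ)) b (fun x _ => hV x.1 x.2)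
    rwa [Finset.card_product, Finset.card_univ, nsmul_eq_mul] at h3
  have h5 := Finset.sum_le_card_nsmul (Finset.range (n + 1)) _ _ h2
  rwa [Finset.card_range, nsmul_eq_mul] at h5

theorem poly_geom (r : ℝ) (hr0 : 0 < r) (hr1 : r < 1) :
    ∃ C ρ : ℝ, 0 < C ∧ 0 < ρ ∧ ρ < 1 ∧ ∀ n : ℕ, ((n + 1 : ℕ) : ℝ) * r ^ n ≤ C * ρ ^ n := by
  obtain ⟨ρ, h1, h2⟩ := exists_between hr1
  have hρ : 0 < ρ := hr0.trans h1
  refine ⟨1 / (1 - r / ρ), ρ, ?_, hρ, h2, fun n => ?_⟩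
  · have : r / ρ < 1 := (div_lt_one hρ).2 h1
    have : 0 < 1 - r / ρ := by linarith
    positivity
  set x := r / ρ with hx
  have hx1 : x < 1 := (div_lt_one hρ).2 h1
  have hx0 : 0 < x := by positivity
  have hrx : r = x * ρ := by rw [hx]; field_simp
  have hpos : 0 < 1 - x := by linarith
  have key : ((n + 1 : ℕ) : ℝ) * x ^ n ≤ 1 / (1 - x) := by
    rw [le_div_iff₀ hpos]
    have hg := geom_sum_mul_neg x (n + 1)
    have h3 : ((n + 1 : ℕ) : ℝ) * x ^ n ≤ ∑ i ∈ Finset.range (n + 1), x ^ i := by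
      have := Finset.card_nsmul_le_sum (Finset.range (n + 1)) (fun i => x ^ i) (x ^ n)
        (fun i hi => pow_le_pow_of_le_one hx0.le hx1.le
          (Nat.lt_succ_iff.1 (Finset.mem_range.1 hi)))
      simpa using this
    have h5 := mul_le_mul_of_nonneg_right h3 hpos.le
    have h6 : 0 < x ^ (n + 1) := by positivity
    linarith
  rw [hrx, mul_pow, ← mul_assoc]
  gcongr

end Final
/-- For an HNN extension `G = ⟨H, t | t a t⁻¹ = φ(a), a ∈ A⟩` with
`[H:A] ≥ 2`, `[H:B] ≥ 2` and a finite symmetric generating set `η : Σ → G`, there are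
constants `C > 0`, `0 < ρ < 1` such that for every `n` the number of cyclically reduced
words of length `n` representing elliptic elements is at most `C·ρⁿ` times the number of
all cyclically reduced words of length `n`. -/
theorem stmt_5 {H : Type*} [Group H] (A B : Subgroup H) (φ : A ≃* B)
    (hA : 2 ≤ Cardinal.mk (H ⧸ A)) (hB : 2 ≤ Cardinal.mk (H ⧸ B))
    {α : Type*} [Fintype α] (η : α → HNNExtension H A B φ) (inv : α → α)
    (hsym : IsSymmetricGen η inv) :
    ∃ C ρ : ℝ, 0 < C ∧ 0 < ρ ∧ ρ < 1 ∧ ∀ n : ℕ,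
      (wordCount {w : List α | CyclicallyReduced inv w ∧
          IsElliptic ((HNNExtension.of : H →* HNNExtension H A B φ).range : Set _)
            (evalWord η w)} n : ℝ) ≤
        C * ρ ^ n * (wordCount {w : List α | CyclicallyReduced inv w} n : ℝ) := by
  classical
  obtain ⟨h, hh⟩ := exists_notMem A hA
  obtain ⟨h', hh'⟩ := exists_notMem B hB
  have h4 := card_four η inv hsym _ _ (not_comm φ h hh)
  obtain ⟨c0⟩ : Nonempty α := Fintype.card_pos_iff.1 (by omega)
  have hp : ∀ (u : ℤˣ) (k : H) (x : XX φ),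
      pinj φ u k x = ((HNNExtension.t ^ (u : ℤ) * HNNExtension.t ^ (u : ℤ) :
        HNNExtension H A B φ)) • x ∨
      pinj φ u k x = (HNNExtension.t ^ (u : ℤ) * HNNExtension.of k *
        (HNNExtension.t ^ (u : ℤ))⁻¹ * HNNExtension.of k : HNNExtension H A B φ) • x := by
    intro u k x
    unfold pinj
    split_ifs
    · right; rfl
    · left; rfl
  obtain ⟨L, hL0, hL⟩ := gap hsym c0 _ _ (pinj_sum φ h h' hh hh') _ _ _ _ (hp 1 h) (hp (-1) h')
  obtain ⟨C, r, hC, hr0, hr1, hdec⟩ := decay hsym h4 L hL0 hL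
  obtain ⟨K, hK⟩ := ell_count φ η inv hsym.1 h4 C r hdec
  obtain ⟨C', ρ, hC', hρ0, hρ1, hpg⟩ := poly_geom r hr0 hr1
  have hq : 0 < ((Fintype.card α - 1 : ℕ) : ℝ) := by
    have : 0 < Fintype.card α - 1 := by omega
    exact_mod_cast this
  refine ⟨(K + 1) * C * C' * ((Fintype.card α - 1 : ℕ) : ℝ), ρ, by positivity, hρ0, hρ1,
    fun n => (hK n).trans ?_⟩
  have hcyc : ((Fintype.card α - 1 : ℕ) : ℝ) ^ n ≤ ((Fintype.card α - 1 : ℕ) : ℝ) *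
      (wordCount {w : List α | CyclicallyReduced inv w} n : ℝ) := by
    exact_mod_cast cyc_count hsym.1 hsym.2.1 h4 n
  set q : ℝ := ((Fintype.card α - 1 : ℕ) : ℝ) with hqd
  calc ((n + 1 : ℕ) : ℝ) * (K * (C * r ^ n * q ^ n))
      = (K * C) * (((n + 1 : ℕ) : ℝ) * r ^ n) * q ^ n := by ring
    _ ≤ ((K + 1) * C) * (C' * ρ ^ n) *
        (q * (wordCount {w : List α | CyclicallyReduced inv w} n : ℝ)) := by
      have := hpg n
      gcongr
      linarith
    _ = _ := by ring
end

section
/- Let G = H ∗_A K with [H : A] = [K : A] = 2, fix h ∈ H \ A and k ∈ K \ A, let P be the canonical image of H or of K in G, and let η : Σ → G be a finite symmetric generating set with η(Σ) contained (as elements of G) in the union of the image of A and {h, h⁻¹, k, k⁻¹}. Then there exist constants c₁, c₂ > 0 such that for every n ≥ 1 the number of words of length 2n over Σ representing an element of P lies between c₁·n^{−1/2}·|Σ|^{2n} and c₂·n^{−1/2}·|Σ|^{2n}; in particular this set of words is not strongly negligible. -/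
universe u

open Monoid

/-- The two-element family of groups used to realize `H ∗_A K` as a pushout. -/
def AmalgFam (H K : Type u) : Bool → Type u
  | true => H
  | false => K

instance amalgFamGroup {H K : Type u} [Group H] [Group K] : (b : Bool) → Group (AmalgFam H K b)
  | true => ‹Group H›
  | false => ‹Group K›

/-- The two inclusions of the amalgamated subgroup `A`. -/
def amalgMaps {A : Type*} [Group A] {H K : Type u} [Group H] [Group K]
    (φ : A →* H) (ψ : A →* K) : (b : Bool) → A →* AmalgFam H K b
  | true => φ
  | false => ψ

/-- The amalgamated free product `H ∗_A K`, i.e. the pushout of the two inclusions of `A`. -/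
abbrev AmalgProd {A : Type*} [Group A] {H K : Type u} [Group H] [Group K]
    (φ : A →* H) (ψ : A →* K) : Type _ :=
  Monoid.PushoutI (amalgMaps φ ψ)

/-- The canonical map `H →* H ∗_A K`. -/
def amalgH {A : Type*} [Group A] {H K : Type u} [Group H] [Group K]
    (φ : A →* H) (ψ : A →* K) : H →* AmalgProd φ ψ :=
  Monoid.PushoutI.of (φ := amalgMaps φ ψ) true

/-- The canonical map `K →* H ∗_A K`. -/
def amalgK {A : Type*} [Group A] {H K : Type u} [Group H] [Group K]
    (φ : A →* H) (ψ : A →* K) : K →* AmalgProd φ ψ :=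
  Monoid.PushoutI.of (φ := amalgMaps φ ψ) false

/-- swap `2i ↔ 2i+1` -/
def sigFun (x : ℤ) : ℤ := if x % 2 = 0 then x + 1 else x - 1
/-- swap `2i-1 ↔ 2i` -/
def tauFun (x : ℤ) : ℤ := if x % 2 = 0 then x - 1 else x + 1

lemma sigFun_invol (x : ℤ) : sigFun (sigFun x) = x := by
  unfold sigFun; split_ifs <;> omega
lemma tauFun_invol (x : ℤ) : tauFun (tauFun x) = x := by
  unfold tauFun; split_ifs <;> omega

def sig : Equiv.Perm ℤ := ⟨sigFun, sigFun, sigFun_invol, sigFun_invol⟩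
def tau : Equiv.Perm ℤ := ⟨tauFun, tauFun, tauFun_invol, tauFun_invol⟩

lemma sig_apply (x : ℤ) : sig x = if x % 2 = 0 then x + 1 else x - 1 := rfl
lemma tau_apply (x : ℤ) : tau x = if x % 2 = 0 then x - 1 else x + 1 := rfl
lemma sig_sig (x : ℤ) : sig (sig x) = x := sigFun_invol x
lemma tau_tau (x : ℤ) : tau (tau x) = x := tauFun_invol x

/-- finite support -/
def FS (f : ℤ → ℝ) : Prop := (Function.support f).Finite

lemma FS.summable {f : ℤ → ℝ} (hf : FS f) : Summable f := summable_of_hasFiniteSupport hf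
lemma FS.mul {f : ℤ → ℝ} (hf : FS f) (g : ℤ → ℝ) : FS (fun x => f x * g x) :=
  Set.Finite.subset hf (by intro x hx; simp at hx ⊢; exact hx.1)
lemma FS.mul' {f : ℤ → ℝ} (hf : FS f) (g : ℤ → ℝ) : FS (fun x => g x * f x) :=
  Set.Finite.subset hf (by intro x hx; simp at hx ⊢; exact hx.2)
lemma FS.sq {f : ℤ → ℝ} (hf : FS f) : FS (fun x => f x ^ 2) := by
  simpa [pow_two] using hf.mul f
lemma FS.add {f g : ℤ → ℝ} (hf : FS f) (hg : FS g) : FS (fun x => f x + g x) :=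
  Set.Finite.subset (hf.union hg) (Function.support_add f g)
lemma FS.sub {f g : ℤ → ℝ} (hf : FS f) (hg : FS g) : FS (fun x => f x - g x) :=
  Set.Finite.subset (hf.union hg) (Function.support_sub f g)
lemma FS.comp {f : ℤ → ℝ} (hf : FS f) (e : Equiv.Perm ℤ) : FS (fun x => f (e x)) :=
  Set.Finite.preimage (e.injective.injOn) hf

/-- the transition operator -/
def stp (p q r : ℝ) (f : ℤ → ℝ) (x : ℤ) : ℝ := p * f x + q * f (sig x) + r * f (tau x)

section
variable {p q r : ℝ}

lemma FS.step {f : ℤ → ℝ} (hf : FS f) : FS (stp p q r f) :=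
  ((hf.mul' (fun _ => p)).add ((hf.comp sig).mul' (fun _ => q))).add
    ((hf.comp tau).mul' (fun _ => r))

lemma FS.iter {f : ℤ → ℝ} (hf : FS f) (n : ℕ) : FS ((stp p q r)^[n] f) := by
  induction n with
  | zero => exact hf
  | succ n ih => rw [Function.iterate_succ_apply']; exact ih.step

/-- self-adjointness -/
lemma stp_adj {f : ℤ → ℝ} (hf : FS f) (g : ℤ → ℝ) :
    ∑' x, stp p q r f x * g x = ∑' x, f x * stp p q r g x := by
  have e1 : ∑' x, f (sig x) * g x = ∑' x, f x * g (sig x) := by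
    rw [← Equiv.tsum_eq sig (fun x => f x * g (sig x))]
    simp only [sig_sig]
  have e2 : ∑' x, f (tau x) * g x = ∑' x, f x * g (tau x) := by
    rw [← Equiv.tsum_eq tau (fun x => f x * g (tau x))]
    simp only [tau_tau]
  have l : ∀ x, stp p q r f x * g x = p * (f x * g x) + q * (f (sig x) * g x)
      + r * (f (tau x) * g x) := by intro x; unfold stp; ring
  have l' : ∀ x, f x * stp p q r g x = p * (f x * g x) + q * (f x * g (sig x))
      + r * (f x * g (tau x)) := by intro x; unfold stp; ring
  have s0 := ((hf.mul g).mul' (fun _ => p)).summable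
  have s1 := (((hf.comp sig).mul g).mul' (fun _ => q)).summable
  have s2 := (((hf.comp tau).mul g).mul' (fun _ => r)).summable
  have s1' := ((hf.mul (fun x => g (sig x))).mul' (fun _ => q)).summable
  have s2' := ((hf.mul (fun x => g (tau x))).mul' (fun _ => r)).summable
  simp_rw [l, l']
  rw [(s0.add s1).tsum_add s2, s0.tsum_add s1, (s0.add s1').tsum_add s2', s0.tsum_add s1']
  simp only [tsum_mul_left, e1, e2]

lemma iter_adj {f g : ℤ → ℝ} (hf : FS f) (n : ℕ) :
    ∑' x, (stp p q r)^[n] f x * g x = ∑' x, f x * (stp p q r)^[n] g x := by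
  induction n generalizing g with
  | zero => rfl
  | succ n ih =>
    rw [Function.iterate_succ_apply', stp_adj (hf.iter n), ih, ← Function.iterate_succ_apply]

lemma stp_mass (hs : p + q + r = 1) {f : ℤ → ℝ} (hf : FS f) :
    ∑' x, stp p q r f x = ∑' x, f x := by
  have := stp_adj (p := p) (q := q) (r := r) hf (fun _ => 1)
  simpa [stp, hs] using this

lemma iter_mass (hs : p + q + r = 1) {f : ℤ → ℝ} (hf : FS f) (n : ℕ) :
    ∑' x, (stp p q r)^[n] f x = ∑' x, f x := by
  induction n with
  | zero => rfl
  | succ n ih => rw [Function.iterate_succ_apply', stp_mass hs (hf.iter n), ih]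

lemma iter_nonneg (hp : 0 ≤ p) (hq : 0 < q) (hr : 0 < r) {f : ℤ → ℝ} (hf : ∀ x, 0 ≤ f x) (n : ℕ) :
    ∀ x, 0 ≤ (stp p q r)^[n] f x := by
  induction n with
  | zero => exact hf
  | succ n ih =>
    intro x
    rw [Function.iterate_succ_apply']
    have h1 := ih x; have h2 := ih (sig x); have h3 := ih (tau x)
    unfold stp; positivity

/-- energy -/
noncomputable def En (f : ℤ → ℝ) : ℝ := ∑' x, (f (x + 2) - f x) ^ 2

lemma stp_energy (hp : 0 ≤ p) (hq : 0 < q) (hr : 0 < r) (hs : p + q + r = 1)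
    {f : ℤ → ℝ} (hf : FS f) :
    ∑' x, stp p q r f x ^ 2 ≤ ∑' x, f x ^ 2 - q * r * En f := by
  have e0 : En f = ∑' x, (f (sig x) - f (tau x)) ^ 2 := by
    unfold En
    rw [← Equiv.tsum_eq (Equiv.subRight (1:ℤ))]
    apply tsum_congr
    intro x
    simp only [Equiv.subRight_apply, sig_apply, tau_apply]
    split_ifs
    · ring_nf
    · ring_nf
  have hm := stp_mass hs hf.sq
  have hE := ((hf.comp sig).sub (hf.comp tau)).sq
  rw [e0, ← hm, ← tsum_mul_left,
    ← (hf.sq.step (p := p) (q := q) (r := r)).summable.tsum_sub (hE.mul' (fun _ => q * r)).summable]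
  apply Summable.tsum_le_tsum _ hf.step.sq.summable
    ((hf.sq.step (p := p) (q := q) (r := r)).sub (hE.mul' (fun _ => q * r))).summable
  intro x
  simp only [stp]
  generalize f x = a, f (sig x) = b, f (tau x) = c
  obtain rfl : p = 1 - q - r := by linarith
  nlinarith [mul_nonneg (mul_nonneg hp hq.le) (sq_nonneg (a - b)),
    mul_nonneg (mul_nonneg hp hr.le) (sq_nonneg (a - c))]

lemma FS.shift {f : ℤ → ℝ} (hf : FS f) (c : ℤ) : FS (fun x => f (x + c)) :=
  hf.comp (Equiv.addRight c)

lemma sup_bound {f : ℤ → ℝ} (hf : FS f) (y : ℤ) :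
    f y ^ 2 ≤ ∑' x, |f (x + 2) ^ 2 - f x ^ 2| := by
  have hG : FS (fun x => |f (x + 2) ^ 2 - f x ^ 2|) :=
    Set.Finite.subset ((hf.shift 2).sq.sub hf.sq) (by intro x hx; simpa using hx)
  -- telescoping
  have tel : ∀ n : ℕ, f y ^ 2 - f (y + 2 * n) ^ 2 ≤
      ∑ i ∈ Finset.range n, |f (y + 2 * i + 2) ^ 2 - f (y + 2 * i) ^ 2| := by
    intro n
    induction n with
    | zero => simp
    | succ n ih =>
      rw [Finset.sum_range_succ]
      have := neg_abs_le (f (y + 2 * n + 2) ^ 2 - f (y + 2 * n) ^ 2)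
      have e : y + 2 * ((n + 1 : ℕ) : ℤ) = y + 2 * n + 2 := by push_cast; ring
      rw [e]; linarith
  have le : ∀ n : ℕ, ∑ i ∈ Finset.range n, |f (y + 2 * i + 2) ^ 2 - f (y + 2 * i) ^ 2| ≤
      ∑' x, |f (x + 2) ^ 2 - f x ^ 2| := by
    intro n
    have inj : Function.Injective (fun i : ℕ => y + 2 * (i : ℤ)) := by
      intro a b h; simp at h; exact h
    have := hG.summable.sum_le_tsum ((Finset.range n).map ⟨_, inj⟩) (fun _ _ => abs_nonneg _)
    simpa using this
  obtain ⟨n, hn⟩ : ∃ n : ℕ, f (y + 2 * n) = 0 := by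
    by_contra! h
    have inj : Function.Injective (fun i : ℕ => y + 2 * (i : ℤ)) := by
      intro a b h; simp at h; exact h
    exact (Set.infinite_of_injective_forall_mem (s := Function.support f) inj h) hf
  have h1 := tel n
  rw [hn] at h1
  have := le n
  linarith

lemma tsum_cs {f g : ℤ → ℝ} (hf : FS f) (hg : FS g) :
    (∑' x, f x * g x) ^ 2 ≤ (∑' x, f x ^ 2) * ∑' x, g x ^ 2 := by
  classical
  have hf' : (Function.support f).Finite := hf
  have hg' : (Function.support g).Finite := hg
  set S := hf'.toFinset ∪ hg'.toFinset
  have e : ∀ h : ℤ → ℝ, (∀ x, f x = 0 → g x = 0 → h x = 0) → ∑' x, h x = ∑ x ∈ S, h x := by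
    intro h hh
    apply tsum_eq_sum
    intro x hx
    simp only [S, Finset.mem_union, Set.Finite.mem_toFinset, Function.mem_support, not_or,
      not_not] at hx
    exact hh x hx.1 hx.2
  rw [e _ (by simp +contextual), e _ (by simp +contextual), e _ (by simp +contextual)]
  exact Finset.sum_mul_sq_le_sq_mul_sq S f g

lemma nash {f : ℤ → ℝ} (hf : FS f) (h0 : ∀ x, 0 ≤ f x) (h1 : ∑' x, f x = 1) :
    (∑' x, f x ^ 2) ^ 3 ≤ 4 * En f := by
  set u := ∑' x, f x ^ 2 with hu
  have hE0 : 0 ≤ En f := tsum_nonneg (fun x => sq_nonneg _)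
  have hu0 : 0 ≤ u := tsum_nonneg (fun x => sq_nonneg _)
  have hA : FS (fun x => |f (x + 2) - f x|) :=
    Set.Finite.subset ((hf.shift 2).sub hf) (by intro x hx; simpa using hx)
  have hB : FS (fun x => f (x + 2) + f x) := (hf.shift 2).add hf
  set T := ∑' x, |f (x + 2) ^ 2 - f x ^ 2| with hT
  have hT0 : 0 ≤ T := tsum_nonneg (fun x => abs_nonneg _)
  have hT1 : T ^ 2 ≤ En f * (4 * u) := by
    have cs := tsum_cs hA hB
    have e1 : ∑' x, |f (x + 2) - f x| * (f (x + 2) + f x) = T := by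
      apply tsum_congr
      intro x
      have : 0 ≤ f (x + 2) + f x := add_nonneg (h0 _) (h0 _)
      rw [show f (x + 2) ^ 2 - f x ^ 2 = (f (x + 2) - f x) * (f (x + 2) + f x) by ring, abs_mul,
        abs_of_nonneg this]
    have e2 : ∑' x, |f (x + 2) - f x| ^ 2 = En f := by simp [En, sq_abs]
    have e3 : ∑' x, (f (x + 2) + f x) ^ 2 ≤ 4 * u := by
      have sh : ∑' x, f (x + 2) ^ 2 = u :=
        Equiv.tsum_eq (Equiv.addRight (2:ℤ)) (fun x => f x ^ 2)
      have : ∑' x, (2 * f (x + 2) ^ 2 + 2 * f x ^ 2) = 4 * u := by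
        rw [((hf.shift 2).sq.mul' (fun _ => 2)).summable.tsum_add
          (hf.sq.mul' (fun _ => 2)).summable, tsum_mul_left, tsum_mul_left, sh, ← hu]
        ring
      rw [← this]
      apply Summable.tsum_le_tsum _ hB.sq.summable
        (((hf.shift 2).sq.mul' (fun _ => 2)).add (hf.sq.mul' (fun _ => 2))).summable
      intro x
      nlinarith [sq_nonneg (f (x + 2) - f x)]
    rw [e1, e2] at cs
    exact cs.trans (mul_le_mul_of_nonneg_left e3 hE0)
  have hsup : ∀ y, f y ≤ Real.sqrt T := fun y => Real.le_sqrt_of_sq_le (sup_bound hf y)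
  have hu1 : u ≤ Real.sqrt T := by
    have : ∑' x, Real.sqrt T * f x = Real.sqrt T := by rw [tsum_mul_left, h1, mul_one]
    rw [← this]
    apply Summable.tsum_le_tsum _ hf.sq.summable (hf.mul' _).summable
    intro x
    rw [pow_two]
    exact mul_le_mul_of_nonneg_right (hsup x) (h0 x)
  have hu2 : u ^ 2 ≤ T := by
    calc u ^ 2 ≤ Real.sqrt T ^ 2 := pow_le_pow_left₀ hu0 hu1 2
      _ = T := Real.sq_sqrt hT0
  have hu4 : u ^ 4 ≤ En f * (4 * u) := by
    calc u ^ 4 = (u ^ 2) ^ 2 := by ring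
      _ ≤ T ^ 2 := pow_le_pow_left₀ (sq_nonneg u) hu2 2
      _ ≤ _ := hT1
  rcases hu0.eq_or_lt with h | h
  · rw [← h]; simpa using hE0
  · have : u * u ^ 3 ≤ u * (4 * En f) := by nlinarith
    exact le_of_mul_le_mul_left this h

def dl (y : ℤ) : ℤ → ℝ := fun x => if x = y then 1 else 0

lemma FS_dl (y : ℤ) : FS (dl y) :=
  Set.Finite.subset (Set.finite_singleton y) (by intro x hx; simpa [dl] using hx)
lemma dl_nonneg (y x : ℤ) : 0 ≤ dl y x := by unfold dl; split_ifs <;> norm_num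
lemma dl_mul (y : ℤ) (g : ℤ → ℝ) : ∑' x, dl y x * g x = g y := by
  rw [tsum_eq_single y (by intro x hx; simp [dl, hx])]; simp [dl]
lemma dl_mass (y : ℤ) : ∑' x, dl y x = 1 := by simpa using dl_mul y (fun _ => 1)

lemma sq_decay (hp : 0 ≤ p) (hq : 0 < q) (hr : 0 < r) (hs : p + q + r = 1) (y : ℤ) (n : ℕ) :
    0 ≤ ∑' x, (stp p q r)^[n] (dl y) x ^ 2 ∧ ∑' x, (stp p q r)^[n] (dl y) x ^ 2 ≤ 1 ∧
    2 * (q * r / 4) * n * (∑' x, (stp p q r)^[n] (dl y) x ^ 2) ^ 2 ≤ 1 := by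
  induction n with
  | zero =>
    have : ∑' x, dl y x ^ 2 = 1 := by
      simp_rw [pow_two]; rw [dl_mul]; simp [dl]
    simp [this]
  | succ n ih =>
    obtain ⟨h0, h1, h2⟩ := ih
    have hF := (FS_dl y).iter (p := p) (q := q) (r := r) n
    have hst := stp_energy hp hq hr hs hF
    have hn := nash hF (iter_nonneg hp hq hr (dl_nonneg y) n)
      (by rw [iter_mass hs (FS_dl y), dl_mass])
    rw [Function.iterate_succ_apply']
    have hw0 : 0 ≤ ∑' x, stp p q r ((stp p q r)^[n] (dl y)) x ^ 2 :=
      tsum_nonneg (fun x => sq_nonneg _)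
    generalize (∑' x, stp p q r ((stp p q r)^[n] (dl y)) x ^ 2) = w at *
    generalize (∑' x, (stp p q r)^[n] (dl y) x ^ 2) = v at *
    generalize En ((stp p q r)^[n] (dl y)) = E at *
    have hc0 : 0 < q * r / 4 := by positivity
    have hc1 : q * r / 4 ≤ 1 := by nlinarith
    have hw : w ≤ v - (q * r / 4) * v ^ 3 := by nlinarith [mul_pos hq hr]
    generalize q * r / 4 = c at *
    have hv2 : v ^ 2 ≤ 1 := by nlinarith
    have hy0 : 0 ≤ c * v ^ 2 := by positivity
    have hy1 : c * v ^ 2 ≤ 1 := by nlinarith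
    have hw' : w ≤ v * (1 - c * v ^ 2) := by nlinarith
    refine ⟨hw0, by nlinarith, ?_⟩
    have hww : w ^ 2 ≤ v ^ 2 * (1 - c * v ^ 2) ^ 2 := by
      rw [← mul_pow]; exact pow_le_pow_left₀ hw0 hw' 2
    have hn0 : (0:ℝ) ≤ n := Nat.cast_nonneg n
    calc 2 * c * ((n + 1 : ℕ) : ℝ) * w ^ 2
        ≤ 2 * c * ((n + 1 : ℕ) : ℝ) * (v ^ 2 * (1 - c * v ^ 2) ^ 2) := by gcongr
      _ = (2 * c * n * v ^ 2 + 2 * (c * v ^ 2)) * (1 - c * v ^ 2) ^ 2 := by push_cast; ring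
      _ ≤ (1 + 2 * (c * v ^ 2)) * (1 - c * v ^ 2) ^ 2 := by gcongr
      _ ≤ 1 := by
        generalize c * v ^ 2 = z at *
        nlinarith [mul_nonneg (sq_nonneg z) (by linarith : (0:ℝ) ≤ 3 - 2 * z)]

lemma iter_two_mul (n : ℕ) (y : ℤ) : (stp p q r)^[2 * n] (dl 0) y =
    ∑' x, (stp p q r)^[n] (dl 0) x * (stp p q r)^[n] (dl y) x := by
  rw [two_mul, Function.iterate_add_apply, ← dl_mul y ((stp p q r)^[n] _)]
  simp_rw [mul_comm (dl y _)]
  rw [iter_adj ((FS_dl 0).iter n)]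

lemma upper (hp : 0 ≤ p) (hq : 0 < q) (hr : 0 < r) (hs : p + q + r = 1) :
    ∃ C : ℝ, 0 < C ∧ ∀ n : ℕ, 1 ≤ n → ∀ y, (stp p q r)^[2 * n] (dl 0) y ≤
      C * (n : ℝ) ^ (-(1/2) : ℝ) := by
  have hc0 : 0 < q * r / 2 := by positivity
  refine ⟨1 / Real.sqrt (q * r / 2), by positivity, fun n hn y => ?_⟩
  have hn0 : (0:ℝ) < n := by exact_mod_cast hn
  set B := 1 / Real.sqrt (q * r / 2) * (n : ℝ) ^ (-(1/2) : ℝ) with hB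
  have hBe : B = 1 / Real.sqrt (q * r / 2 * n) := by
    rw [hB, Real.rpow_neg hn0.le, ← Real.sqrt_eq_rpow, Real.sqrt_mul hc0.le]
    field_simp
  have key : ∀ y : ℤ, ∑' x, (stp p q r)^[n] (dl y) x ^ 2 ≤ B := by
    intro y
    obtain ⟨h0, -, h2⟩ := sq_decay hp hq hr hs y n
    rw [hBe, le_div_iff₀ (by positivity)]
    apply le_of_sq_le_sq _ zero_le_one |>.trans le_rfl
    rw [mul_pow, Real.sq_sqrt (by positivity)]
    linarith
  rw [iter_two_mul]
  have F0 := (FS_dl 0).iter (p := p) (q := q) (r := r) n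
  have Fy := (FS_dl y).iter (p := p) (q := q) (r := r) n
  have : ∑' x, (stp p q r)^[n] (dl 0) x * (stp p q r)^[n] (dl y) x ≤
    ∑' x, ((1/2) * (stp p q r)^[n] (dl 0) x ^ 2 + (1/2) * (stp p q r)^[n] (dl y) x ^ 2) := by
    apply Summable.tsum_le_tsum _ (F0.mul _).summable
      ((F0.sq.mul' (fun _ => 1/2)).add (Fy.sq.mul' (fun _ => 1/2))).summable
    intro x
    nlinarith [sq_nonneg ((stp p q r)^[n] (dl 0) x - (stp p q r)^[n] (dl y) x)]
  rw [(F0.sq.mul' (fun _ => 1/2)).summable.tsum_add (Fy.sq.mul' (fun _ => 1/2)).summable,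
    tsum_mul_left, tsum_mul_left] at this
  linarith [key 0, key y]

/-- harmonic coordinate -/
noncomputable def hc (q r : ℝ) (x : ℤ) : ℝ :=
  if x % 2 = 0 then (x / 2 : ℤ) * (1 / q + 1 / r) else (x / 2 : ℤ) * (1 / q + 1 / r) + 1 / q

lemma hc_stp (hq : 0 < q) (hr : 0 < r) (hs : p + q + r = 1) (x : ℤ) :
    stp p q r (fun x => hc q r x ^ 2) x = hc q r x ^ 2 + (1 / q + 1 / r) := by
  unfold stp
  obtain rfl : p = 1 - q - r := by linarith
  rcases Int.even_or_odd' x with ⟨i, rfl | rfl⟩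
  · have a1 : hc q r (2 * i) = i * (1 / q + 1 / r) := by
      unfold hc; rw [if_pos (by omega)]; congr 2; omega
    have a2 : hc q r (sig (2 * i)) = i * (1 / q + 1 / r) + 1 / q := by
      rw [sig_apply, if_pos (by omega)]
      unfold hc; rw [if_neg (by omega)]; congr 3; omega
    have a3 : hc q r (tau (2 * i)) = (i - 1) * (1 / q + 1 / r) + 1 / q := by
      rw [tau_apply, if_pos (by omega)]
      unfold hc; rw [if_neg (by omega), show (2 * i - 1) / 2 = i - 1 by omega]; push_cast; rfl
    simp only [a1, a2, a3]
    field_simp; ring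
  · have a1 : hc q r (2 * i + 1) = i * (1 / q + 1 / r) + 1 / q := by
      unfold hc; rw [if_neg (by omega)]; congr 3; omega
    have a2 : hc q r (sig (2 * i + 1)) = i * (1 / q + 1 / r) := by
      rw [sig_apply, if_neg (by omega)]
      unfold hc; rw [if_pos (by omega)]; congr 2; omega
    have a3 : hc q r (tau (2 * i + 1)) = (i + 1) * (1 / q + 1 / r) := by
      rw [tau_apply, if_neg (by omega)]
      unfold hc; rw [if_pos (by omega), show (2 * i + 1 + 1) / 2 = i + 1 by omega]; push_cast; rfl
    simp only [a1, a2, a3]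
    field_simp; ring

lemma hc_ge (hq : 0 < q) (hr : 0 < r) (hq1 : q ≤ 1) (hr1 : r ≤ 1) (x : ℤ) :
    (x : ℝ) ^ 2 ≤ hc q r x ^ 2 := by
  have h1 : 1 ≤ 1 / q := by rw [le_div_iff₀ hq]; linarith
  have h2 : 1 ≤ 1 / r := by rw [le_div_iff₀ hr]; linarith
  rw [sq_le_sq]
  unfold hc
  generalize 1 / q = a at *
  generalize 1 / r = b at *
  rcases Int.even_or_odd' x with ⟨i, rfl | rfl⟩
  · rw [if_pos (by omega), show (2 * i) / 2 = i by omega, abs_mul, abs_of_pos (by linarith : 0 < a + b)]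
    push_cast
    rw [abs_mul, abs_two]
    nlinarith [abs_nonneg (i : ℝ)]
  · rw [if_neg (by omega), show (2 * i + 1) / 2 = i by omega]
    push_cast
    rcases le_or_gt 0 i with hi | hi
    · have hi' : (0:ℝ) ≤ i := by exact_mod_cast hi
      rw [abs_of_nonneg (by positivity)]
      refine le_trans ?_ (le_abs_self _)
      nlinarith
    · have hi' : (i:ℝ) ≤ -1 := by exact_mod_cast (by omega : i ≤ -1)
      rw [abs_of_nonpos (by linarith)]
      refine le_trans ?_ (neg_le_abs _)
      nlinarith

lemma lower (hp : 0 ≤ p) (hq : 0 < q) (hr : 0 < r) (hs : p + q + r = 1) :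
    ∃ c : ℝ, 0 < c ∧ ∀ n : ℕ, 1 ≤ n →
      c * (n : ℝ) ^ (-(1/2) : ℝ) ≤ (stp p q r)^[2 * n] (dl 0) 0 := by
  set D := 1 / q + 1 / r with hD
  have hD0 : 0 < D := by positivity
  refine ⟨1 / (4 * (2 * Real.sqrt (2 * D) + 3)), by positivity, fun n hn => ?_⟩
  have hn1 : (1:ℝ) ≤ n := by exact_mod_cast hn
  have hn0 : (0:ℝ) < n := by linarith
  set f := (stp p q r)^[n] (dl 0) with hf
  have F : FS f := (FS_dl 0).iter n
  have f0 : ∀ x, 0 ≤ f x := iter_nonneg hp hq hr (dl_nonneg 0) n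
  have f1 : ∑' x, f x = 1 := by rw [hf, iter_mass hs (FS_dl 0), dl_mass]
  have mom : ∀ m : ℕ, ∑' x, (stp p q r)^[m] (dl 0) x * hc q r x ^ 2 = D * m := by
    intro m
    induction m with
    | zero =>
      simp only [Function.iterate_zero, id]
      rw [dl_mul]; simp [hc]
    | succ m ih =>
      rw [Function.iterate_succ_apply', stp_adj ((FS_dl 0).iter m) (fun x => hc q r x ^ 2)]
      simp_rw [hc_stp hq hr hs, ← hD, mul_add]
      rw [(((FS_dl 0).iter m).mul _).summable.tsum_add (((FS_dl 0).iter m).mul _).summable, ih,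
        tsum_mul_right, iter_mass hs (FS_dl 0), dl_mass]
      push_cast; ring
  have mom2 : ∑' x, f x * (x:ℝ) ^ 2 ≤ D * n := by
    rw [← mom n]
    apply Summable.tsum_le_tsum _ (F.mul _).summable (F.mul _).summable
    intro x
    exact mul_le_mul_of_nonneg_left (hc_ge hq hr (by linarith) (by linarith) x) (f0 x)
  set R : ℕ := ⌈Real.sqrt (2 * D * n)⌉₊ with hR
  have hR1 : Real.sqrt (2 * D * n) ≤ R := Nat.le_ceil _
  have hR2 : (R:ℝ) < Real.sqrt (2 * D * n) + 1 := Nat.ceil_lt_add_one (Real.sqrt_nonneg _)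
  have hRsq : 2 * D * n ≤ (R:ℝ) ^ 2 := by
    rw [← Real.sqrt_le_left (by positivity)]; exact hR1
  set S : Finset ℤ := Finset.Icc (-(R:ℤ)) R with hS
  have hcard : (S.card : ℝ) = 2 * R + 1 := by
    rw [hS, Int.card_Icc]
    have : ((R:ℤ) + 1 - -(R:ℤ)).toNat = 2 * R + 1 := by omega
    rw [this]; push_cast; ring
  -- half the mass
  have half : 1 / 2 ≤ ∑ x ∈ S, f x := by
    have G : FS (fun x => if x ∈ S then f x else 0) :=
      Set.Finite.subset F (by intro x hx; simp at hx ⊢; exact hx.2)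
    have e : ∑ x ∈ S, f x = ∑' x, if x ∈ S then f x else 0 := by
      rw [tsum_eq_sum (s := S) (by intro x hx; simp [hx])]
      apply Finset.sum_congr rfl; intro x hx; simp [hx]
    have : ∑' x, f x ≤ ∑' x, ((if x ∈ S then f x else 0) + (1 / (2 * D * n)) * (f x * (x:ℝ)^2)) := by
      apply Summable.tsum_le_tsum _ F.summable
        (G.add ((F.mul _).mul' (fun _ => 1 / (2 * D * n)))).summable
      intro x
      have hx0 : 0 ≤ (1 / (2 * D * n)) * (f x * (x:ℝ)^2) := by have := f0 x; positivity
      by_cases hx : x ∈ S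
      · rw [if_pos hx]; linarith
      · rw [if_neg hx, zero_add]
        have hx2 : 2 * D * n ≤ (x:ℝ) ^ 2 := by
          refine hRsq.trans ?_
          have : (R:ℤ) ^ 2 ≤ x ^ 2 := by
            rw [sq_le_sq, Nat.abs_cast]
            simp only [hS, Finset.mem_Icc, not_and_or, not_le] at hx
            rcases hx with hx | hx
            · exact le_trans (by omega) (neg_le_abs x)
            · exact le_trans (by omega) (le_abs_self x)
          exact_mod_cast this
        rw [div_mul_eq_mul_div, one_mul, le_div_iff₀ (by positivity)]
        exact mul_le_mul_of_nonneg_left hx2 (f0 x)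
    rw [G.summable.tsum_add ((F.mul _).mul' (fun _ => 1 / (2 * D * n))).summable, ← e, f1,
      tsum_mul_left] at this
    have h3 : (1 / (2 * D * n)) * ∑' x, f x * (x:ℝ)^2 ≤ (1 / (2 * D * n)) * (D * n) := by gcongr
    have h4 : (1 / (2 * D * n)) * (D * n) = 1 / 2 := by field_simp
    linarith
  have cs : (∑ x ∈ S, f x) ^ 2 ≤ S.card * ∑ x ∈ S, f x ^ 2 := sq_sum_le_card_mul_sum_sq
  have le : ∑ x ∈ S, f x ^ 2 ≤ ∑' x, f x ^ 2 := F.sq.summable.sum_le_tsum S (fun _ _ => sq_nonneg _)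
  have eq : (stp p q r)^[2 * n] (dl 0) 0 = ∑' x, f x ^ 2 := by
    rw [iter_two_mul]; simp_rw [pow_two]; rfl
  rw [eq]
  have hu0 : 0 ≤ ∑' x, f x ^ 2 := tsum_nonneg fun x => sq_nonneg _
  generalize (∑' x, f x ^ 2) = u at *
  have hsn : 1 ≤ Real.sqrt n := Real.one_le_sqrt.mpr hn1
  have hcb : 2 * (R:ℝ) + 1 ≤ (2 * Real.sqrt (2 * D) + 3) * Real.sqrt n := by
    rw [Real.sqrt_mul (by positivity)] at hR2
    nlinarith
  have h5 : 1 / 4 ≤ (2 * Real.sqrt (2 * D) + 3) * Real.sqrt n * u := by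
    have : (1:ℝ) / 4 ≤ (∑ x ∈ S, f x) ^ 2 := by nlinarith
    calc (1:ℝ) / 4 ≤ _ := this
      _ ≤ _ := cs
      _ ≤ (2 * R + 1) * u := by rw [hcard]; gcongr
      _ ≤ _ := by gcongr
  rw [Real.rpow_neg hn0.le, ← Real.sqrt_eq_rpow, ← one_div, div_mul_div_comm, div_le_iff₀ (by positivity)]
  linarith
end
lemma sig_mul : sig * sig = 1 := by ext x; exact sig_sig x
lemma tau_mul : tau * tau = 1 := by ext x; exact tau_tau x
lemma sig_tau_ne : sig * tau ≠ tau * sig := by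
  intro h
  have := congrArg (fun e : Equiv.Perm ℤ => e 0) h
  simp [sig_apply, tau_apply] at this

open Classical in
/-- The homomorphism with kernel an index two subgroup. -/
noncomputable def indHom {X : Type*} [Group X] (N : Subgroup X) (hN : N.index = 2)
    (e : Equiv.Perm ℤ) (he : e * e = 1) : X →* Equiv.Perm ℤ where
  toFun x := if x ∈ N then 1 else e
  map_one' := by simp [N.one_mem]
  map_mul' x y := by
    have := Subgroup.mul_mem_iff_of_index_two hN (a := x) (b := y)
    by_cases hx : x ∈ N <;> by_cases hy : y ∈ N <;> simp [this, hx, hy, he]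

section
variable {A : Type*} {H K : Type u} [Group A] [Group H] [Group K]
    (φ : A →* H) (ψ : A →* K) (hH2 : φ.range.index = 2) (hK2 : ψ.range.index = 2)

noncomputable def thFam : (b : Bool) → AmalgFam H K b →* Equiv.Perm ℤ
  | true => indHom φ.range hH2 sig sig_mul
  | false => indHom ψ.range hK2 tau tau_mul

noncomputable def th : AmalgProd φ ψ →* Equiv.Perm ℤ :=
  Monoid.PushoutI.lift (thFam φ ψ hH2 hK2) 1 (by
    intro b
    ext1 a
    cases b
    · exact if_pos ⟨a, rfl⟩
    · exact if_pos ⟨a, rfl⟩)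

open Classical in
lemma th_H (x : H) : th φ ψ hH2 hK2 (amalgH φ ψ x) = if x ∈ φ.range then 1 else sig := by
  unfold th amalgH
  erw [Monoid.PushoutI.lift_of]
  rfl
open Classical in
lemma th_K (x : K) : th φ ψ hH2 hK2 (amalgK φ ψ x) = if x ∈ ψ.range then 1 else tau := by
  unfold th amalgK
  erw [Monoid.PushoutI.lift_of]
  rfl

lemma HK_eq (a : A) : amalgH φ ψ (φ a) = amalgK φ ψ (ψ a) :=
  (Monoid.PushoutI.of_apply_eq_base (amalgMaps φ ψ) true a).trans
    (Monoid.PushoutI.of_apply_eq_base (amalgMaps φ ψ) false a).symm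

/-- image of `A` -/
def NA : Subgroup (AmalgProd φ ψ) := ((amalgH φ ψ).comp φ).range

lemma mem_NA_H {x : H} (hx : x ∈ φ.range) : amalgH φ ψ x ∈ NA φ ψ := by
  obtain ⟨a, rfl⟩ := hx; exact ⟨a, rfl⟩
lemma mem_NA_K {x : K} (hx : x ∈ ψ.range) : amalgK φ ψ x ∈ NA φ ψ := by
  obtain ⟨a, rfl⟩ := hx; exact ⟨a, HK_eq φ ψ a⟩

lemma NA_normal (hH2 : φ.range.index = 2) (hK2 : ψ.range.index = 2) : (NA φ ψ).Normal := by
  have nH : φ.range.Normal := Subgroup.normal_of_index_eq_two hH2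
  have nK : ψ.range.Normal := Subgroup.normal_of_index_eq_two hK2
  have cH : ∀ (x : H), ∀ n ∈ NA φ ψ, amalgH φ ψ x * n * (amalgH φ ψ x)⁻¹ ∈ NA φ ψ := by
    rintro x _ ⟨a, rfl⟩
    have := mem_NA_H φ ψ (nH.conj_mem (φ a) ⟨a, rfl⟩ x)
    simpa using this
  have cK : ∀ (x : K), ∀ n ∈ NA φ ψ, amalgK φ ψ x * n * (amalgK φ ψ x)⁻¹ ∈ NA φ ψ := by
    rintro x _ ⟨a, rfl⟩
    have := mem_NA_K φ ψ (nK.conj_mem (ψ a) ⟨a, rfl⟩ x)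
    simpa [← HK_eq] using this
  constructor
  intro n hn g
  induction g using Monoid.PushoutI.induction_on generalizing n with
  | of i g => cases i with
    | true => exact cH g n hn
    | false => exact cK g n hn
  | base a =>
    have := cH (φ a) n hn
    rw [show amalgH φ ψ (φ a) = _ from
      Monoid.PushoutI.of_apply_eq_base (amalgMaps φ ψ) true a] at this
    exact this
  | mul x y hx hy =>
    have := hx _ (hy n hn)
    simpa [mul_assoc] using this

/-- The representative of the coset with position `x`. -/
def rep {Q : Type*} [Group Q] (s t : Q) (x : ℤ) : Q :=
  if x % 2 = 0 then (t * s) ^ (x / 2) else s * (t * s) ^ (x / 2)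

lemma rep_sig {Q : Type*} [Group Q] (s t : Q) (hs : s * s = 1) (x : ℤ) :
    rep s t (sig x) = s * rep s t x := by
  unfold rep
  rw [sig_apply]
  by_cases h : x % 2 = 0
  · rw [if_pos h, if_pos h, if_neg (by omega), show (x + 1) / 2 = x / 2 by omega]
  · rw [if_neg h, if_neg h, if_pos (by omega), show (x - 1) / 2 = x / 2 by omega, ← mul_assoc, hs,
      one_mul]

lemma rep_tau {Q : Type*} [Group Q] (s t : Q) (ht : t * t = 1) (x : ℤ) :
    rep s t (tau x) = t * rep s t x := by
  unfold rep
  rw [tau_apply]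
  by_cases h : x % 2 = 0
  · rw [if_pos h, if_pos h, if_neg (by omega), show (x - 1) / 2 = x / 2 - 1 by omega]
    have : (t * s) ^ (x / 2) = (t * s) * (t * s) ^ (x / 2 - 1) := by
      rw [← zpow_one_add]; congr 1; ring
    rw [this, ← mul_assoc, ← mul_assoc, ht, one_mul]
  · rw [if_neg h, if_neg h, if_pos (by omega), show (x + 1) / 2 = 1 + x / 2 by omega, zpow_one_add,
      mul_assoc]

/-- every letter acts trivially, as `sig` or as `tau`, compatibly with the quotient by `A`. -/
lemma letter_cases (h : H) (hh : h ∉ φ.range) (k : K) (hk : k ∉ ψ.range) (g : AmalgProd φ ψ)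
    (hg : g ∈ (((amalgH φ ψ).comp φ).range : Set (AmalgProd φ ψ)) ∪
      {amalgH φ ψ h, (amalgH φ ψ h)⁻¹, amalgK φ ψ k, (amalgK φ ψ k)⁻¹}) :
    (th φ ψ hH2 hK2 g = 1 ∧ (g : AmalgProd φ ψ ⧸ NA φ ψ) = (1 : AmalgProd φ ψ)) ∨
    (th φ ψ hH2 hK2 g = sig ∧ (g : AmalgProd φ ψ ⧸ NA φ ψ) = amalgH φ ψ h) ∨
    (th φ ψ hH2 hK2 g = tau ∧ (g : AmalgProd φ ψ ⧸ NA φ ψ) = amalgK φ ψ k) := by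
  have hh' : h⁻¹ ∉ φ.range := by simpa only [inv_mem_iff] using hh
  have hk' : k⁻¹ ∉ ψ.range := by simpa only [inv_mem_iff] using hk
  rcases hg with ⟨a, rfl⟩ | hg
  · left
    constructor
    · simp only [MonoidHom.comp_apply]; rw [th_H, if_pos ⟨a, rfl⟩]
    · rw [QuotientGroup.eq]; simp only [mul_one, inv_mem_iff]; exact ⟨a, rfl⟩
  · simp only [Set.mem_insert_iff, Set.mem_singleton_iff] at hg
    rcases hg with rfl | rfl | rfl | rfl
    · right; left; exact ⟨by rw [th_H, if_neg hh], rfl⟩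
    · right; left
      refine ⟨by rw [← map_inv, th_H, if_neg hh'], ?_⟩
      rw [QuotientGroup.eq, inv_inv, ← map_mul]
      exact mem_NA_H φ ψ (Subgroup.mul_self_mem_of_index_two hH2 h)
    · right; right; exact ⟨by rw [th_K, if_neg hk], rfl⟩
    · right; right
      refine ⟨by rw [← map_inv, th_K, if_neg hk'], ?_⟩
      rw [QuotientGroup.eq, inv_inv, ← map_mul]
      exact mem_NA_K φ ψ (Subgroup.mul_self_mem_of_index_two hK2 k)

lemma coset_eq (h : H) (hh : h ∉ φ.range) (k : K) (hk : k ∉ ψ.range)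
    [(NA φ ψ).Normal] {α : Type*} (η : α → AmalgProd φ ψ)
    (hrange : ∀ a : α, η a ∈ (((amalgH φ ψ).comp φ).range : Set (AmalgProd φ ψ)) ∪
      {amalgH φ ψ h, (amalgH φ ψ h)⁻¹, amalgK φ ψ k, (amalgK φ ψ k)⁻¹}) (w : List α) :
    ((evalWord η w : AmalgProd φ ψ) : AmalgProd φ ψ ⧸ NA φ ψ) =
      rep (amalgH φ ψ h : AmalgProd φ ψ ⧸ NA φ ψ) (amalgK φ ψ k : AmalgProd φ ψ ⧸ NA φ ψ)
        (th φ ψ hH2 hK2 (evalWord η w) 0) := by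
  have hs : (amalgH φ ψ h : AmalgProd φ ψ ⧸ NA φ ψ) * (amalgH φ ψ h : AmalgProd φ ψ ⧸ NA φ ψ)
      = 1 := by
    rw [← QuotientGroup.mk_mul, QuotientGroup.eq_one_iff, ← map_mul]
    exact mem_NA_H φ ψ (Subgroup.mul_self_mem_of_index_two hH2 h)
  have ht : (amalgK φ ψ k : AmalgProd φ ψ ⧸ NA φ ψ) * (amalgK φ ψ k : AmalgProd φ ψ ⧸ NA φ ψ)
      = 1 := by
    rw [← QuotientGroup.mk_mul, QuotientGroup.eq_one_iff, ← map_mul]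
    exact mem_NA_K φ ψ (Subgroup.mul_self_mem_of_index_two hK2 k)
  induction w with
  | nil => simp [evalWord, rep]
  | cons a w ih =>
    have e : evalWord η (a :: w) = η a * evalWord η w := by simp [evalWord]
    rw [e, QuotientGroup.mk_mul, ih, map_mul, Equiv.Perm.mul_apply]
    rcases letter_cases φ ψ hH2 hK2 h hh k hk (η a) (hrange a) with ⟨h1, h2⟩ | ⟨h1, h2⟩ | ⟨h1, h2⟩
    · rw [h1, h2]; simp
    · rw [h1, h2, rep_sig _ _ hs]
    · rw [h1, h2, rep_tau _ _ ht]

lemma mem_H_iff (h : H) (hh : h ∉ φ.range) (k : K) (hk : k ∉ ψ.range)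
    {α : Type*} (η : α → AmalgProd φ ψ)
    (hrange : ∀ a : α, η a ∈ (((amalgH φ ψ).comp φ).range : Set (AmalgProd φ ψ)) ∪
      {amalgH φ ψ h, (amalgH φ ψ h)⁻¹, amalgK φ ψ k, (amalgK φ ψ k)⁻¹}) (w : List α) :
    evalWord η w ∈ (amalgH φ ψ).range ↔
      th φ ψ hH2 hK2 (evalWord η w) 0 = 0 ∨ th φ ψ hH2 hK2 (evalWord η w) 0 = 1 := by
  have := NA_normal φ ψ hH2 hK2
  have hN : NA φ ψ ≤ (amalgH φ ψ).range := by rintro _ ⟨a, rfl⟩; exact ⟨φ a, rfl⟩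
  constructor
  · rintro ⟨x, hx⟩
    rw [← hx, th_H]
    split_ifs
    · left; rfl
    · right; rfl
  · have c := coset_eq φ ψ hH2 hK2 h hh k hk η hrange w
    rintro (h0 | h0)
    · rw [h0] at c
      simp only [rep] at c
      rw [if_pos (by norm_num)] at c
      simp only [Int.zero_ediv, zpow_zero] at c
      rw [QuotientGroup.eq_one_iff] at c
      exact hN c
    · rw [h0] at c
      simp only [rep] at c
      rw [if_neg (by norm_num)] at c
      simp only [show (1:ℤ) / 2 = 0 by norm_num, zpow_zero, mul_one] at c
      rw [eq_comm, QuotientGroup.eq] at c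
      have hm : amalgH φ ψ h ∈ (amalgH φ ψ).range := ⟨h, rfl⟩
      exact (Subgroup.mul_mem_cancel_left _ (inv_mem hm)).1 (hN c)

lemma mem_K_iff (h : H) (hh : h ∉ φ.range) (k : K) (hk : k ∉ ψ.range)
    {α : Type*} (η : α → AmalgProd φ ψ)
    (hrange : ∀ a : α, η a ∈ (((amalgH φ ψ).comp φ).range : Set (AmalgProd φ ψ)) ∪
      {amalgH φ ψ h, (amalgH φ ψ h)⁻¹, amalgK φ ψ k, (amalgK φ ψ k)⁻¹}) (w : List α) :
    evalWord η w ∈ (amalgK φ ψ).range ↔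
      th φ ψ hH2 hK2 (evalWord η w) 0 = 0 ∨ th φ ψ hH2 hK2 (evalWord η w) 0 = -1 := by
  have := NA_normal φ ψ hH2 hK2
  have hN : NA φ ψ ≤ (amalgK φ ψ).range := by
    rintro _ ⟨a, rfl⟩; exact ⟨ψ a, (HK_eq φ ψ a).symm⟩
  constructor
  · rintro ⟨x, hx⟩
    rw [← hx, th_K]
    split_ifs
    · left; rfl
    · right; rfl
  · have c := coset_eq φ ψ hH2 hK2 h hh k hk η hrange w
    rintro (h0 | h0)
    · rw [h0] at c
      simp only [rep] at c
      rw [if_pos (by norm_num)] at c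
      simp only [Int.zero_ediv, zpow_zero] at c
      rw [QuotientGroup.eq_one_iff] at c
      exact hN c
    · rw [h0] at c
      simp only [rep] at c
      rw [if_neg (by norm_num)] at c
      simp only [show (-1:ℤ) / 2 = -1 by norm_num, zpow_neg, zpow_one, mul_inv_rev] at c
      rw [mul_inv_cancel_left, ← QuotientGroup.mk_inv, eq_comm, QuotientGroup.eq] at c
      have hm : amalgK φ ψ k ∈ (amalgK φ ψ).range := ⟨k, rfl⟩
      exact (Subgroup.mul_mem_cancel_left _ (inv_mem (inv_mem hm))).1 (hN c)

end
section
variable {α : Type*} [Fintype α]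

lemma wc_finite (L : Set (List α)) (n : ℕ) : (L ∩ {w | w.length = n}).Finite :=
  (List.finite_length_eq α n).subset Set.inter_subset_right

lemma wc_ncard (L : Set (List α)) (n : ℕ) :
    wordCount L n = (L ∩ {w | w.length = n}).ncard := rfl

lemma wc_mono {L M : Set (List α)} (h : L ⊆ M) (n : ℕ) : wordCount L n ≤ wordCount M n := by
  rw [wc_ncard, wc_ncard]
  exact Set.ncard_le_ncard (Set.inter_subset_inter_left _ h) (wc_finite M n)

lemma wc_union (L M : Set (List α)) (n : ℕ) :
    wordCount (L ∪ M) n ≤ wordCount L n + wordCount M n := by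
  rw [wc_ncard, wc_ncard, wc_ncard, Set.union_inter_distrib_right]
  exact Set.ncard_union_le _ _

lemma wc_succ (L : Set (List α)) (n : ℕ) :
    wordCount L (n + 1) = ∑ a, wordCount {w | a :: w ∈ L} n := by
  unfold wordCount
  have : ∀ a : α, Finite {w : List α // w ∈ {w | a :: w ∈ L} ∧ w.length = n} :=
    fun a => (wc_finite {w | a :: w ∈ L} n).to_subtype
  rw [← Nat.card_sigma]
  refine Nat.card_congr ⟨fun w => ?_, fun v => ⟨v.1 :: v.2.1, v.2.2.1, by simp [v.2.2.2]⟩, ?_, ?_⟩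
  · rcases w with ⟨_ | ⟨a, w⟩, h1, h2⟩
    · simp at h2
    · exact ⟨a, w, h1, by simpa using h2⟩
  · rintro ⟨_ | ⟨a, w⟩, h1, h2⟩
    · simp at h2
    · rfl
  · rintro ⟨a, w, h1, h2⟩
    rfl

/-- final position of a word -/
def posT (T : α → Equiv.Perm ℤ) (w : List α) : ℤ := (w.map T).prod 0

lemma wc_zero (T : α → Equiv.Perm ℤ) (x : ℤ) :
    (wordCount {w | posT T w = x} 0 : ℝ) = dl 0 x := by
  rw [wc_ncard]
  by_cases h : x = 0
  · subst h
    have : ({w | posT T w = 0} ∩ {w | w.length = 0} : Set (List α)) = {[]} := by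
      ext w; simp only [Set.mem_inter_iff, Set.mem_ofPred_eq, List.length_eq_zero_iff,
        Set.mem_singleton_iff]
      constructor
      · exact fun h => h.2
      · rintro rfl; simp [posT]
    rw [this]; simp [dl]
  · have : ({w | posT T w = x} ∩ {w | w.length = 0} : Set (List α)) = ∅ := by
      ext w; simp only [Set.mem_inter_iff, Set.mem_ofPred_eq, List.length_eq_zero_iff,
        Set.mem_empty_iff_false, iff_false, not_and]
      rintro h1 rfl
      simp [posT] at h1
      exact h h1.symm
    rw [this]; simp [dl, h]

open Classical in
noncomputable def mult (T : α → Equiv.Perm ℤ) (e : Equiv.Perm ℤ) : ℝ :=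
  ((Finset.univ.filter (fun a => T a = e)).card : ℝ)

lemma sig_ne_one : sig ≠ 1 := by
  intro h; have := congrArg (fun e : Equiv.Perm ℤ => e 0) h; simp [sig_apply] at this
lemma tau_ne_one : tau ≠ 1 := by
  intro h; have := congrArg (fun e : Equiv.Perm ℤ => e 0) h; simp [tau_apply] at this
lemma sig_ne_tau : sig ≠ tau := by
  intro h; exact sig_tau_ne (by rw [h])

lemma sum_T (T : α → Equiv.Perm ℤ) (hT : ∀ a, T a = 1 ∨ T a = sig ∨ T a = tau)
    (g : ℤ → ℝ) (x : ℤ) :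
    ∑ a, g ((T a)⁻¹ x) = mult T 1 * g x + mult T sig * g (sig x) + mult T tau * g (tau x) := by
  classical
  have hs : sig⁻¹ = sig := inv_eq_of_mul_eq_one_left sig_mul
  have ht : tau⁻¹ = tau := inv_eq_of_mul_eq_one_left tau_mul
  have : ∀ a, g ((T a)⁻¹ x) = (if T a = 1 then g x else 0) + (if T a = sig then g (sig x) else 0)
      + (if T a = tau then g (tau x) else 0) := by
    intro a
    rcases hT a with h | h | h
    · simp [h, sig_ne_one.symm, tau_ne_one.symm]
    · simp [h, hs, sig_ne_one, sig_ne_tau]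
    · simp [h, ht, tau_ne_one, sig_ne_tau.symm]
  simp_rw [this]
  rw [Finset.sum_add_distrib, Finset.sum_add_distrib]
  simp only [← Finset.sum_filter, Finset.sum_const, nsmul_eq_mul]
  unfold mult
  congr!

lemma wc_eq (T : α → Equiv.Perm ℤ) (hT : ∀ a, T a = 1 ∨ T a = sig ∨ T a = tau)
    (hN : (0:ℝ) < Fintype.card α) (n : ℕ) (x : ℤ) :
    (wordCount {w | posT T w = x} n : ℝ) = (Fintype.card α : ℝ) ^ n *
      (stp (mult T 1 / Fintype.card α) (mult T sig / Fintype.card α)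
        (mult T tau / Fintype.card α))^[n] (dl 0) x := by
  induction n generalizing x with
  | zero => rw [wc_zero]; simp
  | succ n ih =>
    rw [wc_succ, Function.iterate_succ_apply']
    have e : ∀ a : α, {w | a :: w ∈ {w | posT T w = x}} = {w | posT T w = (T a)⁻¹ x} := by
      intro a; ext w
      simp only [Set.mem_ofPred_eq, posT, List.map_cons, List.prod_cons, Equiv.Perm.mul_apply]
      rw [Equiv.Perm.eq_inv_iff_eq]
    simp_rw [e]
    push_cast
    simp_rw [ih]
    rw [sum_T T hT (fun y => (Fintype.card α : ℝ) ^ n *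
      (stp (mult T 1 / Fintype.card α) (mult T sig / Fintype.card α)
        (mult T tau / Fintype.card α))^[n] (dl 0) y)]
    rw [stp]
    field_simp
    ring

lemma main_count (T : α → Equiv.Perm ℤ) (hT : ∀ a, T a = 1 ∨ T a = sig ∨ T a = tau)
    (hs : ∃ a, T a = sig) (ht : ∃ a, T a = tau) (y : ℤ) :
    (∃ c₁ c₂ : ℝ, 0 < c₁ ∧ 0 < c₂ ∧ ∀ n : ℕ, 1 ≤ n →
      c₁ * (n : ℝ) ^ (-(1/2) : ℝ) * (Fintype.card α : ℝ) ^ (2 * n) ≤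
        (wordCount ({w : List α | posT T w = 0} ∪ {w | posT T w = y}) (2 * n) : ℝ) ∧
      (wordCount ({w : List α | posT T w = 0} ∪ {w | posT T w = y}) (2 * n) : ℝ) ≤
        c₂ * (n : ℝ) ^ (-(1/2) : ℝ) * (Fintype.card α : ℝ) ^ (2 * n)) ∧
    ¬ StronglyNegligible ({w : List α | posT T w = 0} ∪ {w | posT T w = y}) := by
  classical
  have hN : (0:ℝ) < Fintype.card α := by
    obtain ⟨a, -⟩ := hs
    have : Nonempty α := ⟨a⟩
    exact_mod_cast Fintype.card_pos
  have mpos : ∀ e, (∃ a, T a = e) → 0 < mult T e := by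
    rintro e ⟨a, ha⟩
    unfold mult
    exact_mod_cast Finset.card_pos.2 ⟨a, by simp [ha]⟩
  have hm : mult T 1 + mult T sig + mult T tau = Fintype.card α := by
    have := sum_T T hT (fun _ => 1) 0
    simp at this
    linarith
  have hp : 0 ≤ mult T 1 / Fintype.card α := by unfold mult; positivity
  have hq : 0 < mult T sig / Fintype.card α := div_pos (mpos _ hs) hN
  have hr : 0 < mult T tau / Fintype.card α := div_pos (mpos _ ht) hN
  have hsum : mult T 1 / Fintype.card α + mult T sig / Fintype.card α +
      mult T tau / Fintype.card α = 1 := by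
    rw [← add_div, ← add_div, hm, div_self hN.ne']
  obtain ⟨C, hC, hup⟩ := upper hp hq hr hsum
  obtain ⟨c, hc, hlo⟩ := lower hp hq hr hsum
  have hwc := wc_eq T hT hN
  generalize stp (mult T 1 / Fintype.card α) (mult T sig / Fintype.card α)
        (mult T tau / Fintype.card α) = Q at *
  have low : ∀ n : ℕ, 1 ≤ n → c * (n : ℝ) ^ (-(1/2) : ℝ) * (Fintype.card α : ℝ) ^ (2 * n) ≤
        (wordCount ({w : List α | posT T w = 0} ∪ {w | posT T w = y}) (2 * n) : ℝ) := by
    intro n hn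
    have h1 : (wordCount {w : List α | posT T w = 0} (2 * n) : ℝ) ≤
        (wordCount ({w : List α | posT T w = 0} ∪ {w | posT T w = y}) (2 * n) : ℝ) := by
      exact_mod_cast wc_mono Set.subset_union_left _
    refine le_trans ?_ h1
    rw [hwc, mul_comm]
    exact mul_le_mul_of_nonneg_left (hlo n hn) (by positivity)
  refine ⟨⟨c, 2 * C, hc, by positivity, fun n hn => ⟨low n hn, ?_⟩⟩, ?_⟩
  · have h1 : (wordCount ({w : List α | posT T w = 0} ∪ {w | posT T w = y}) (2 * n) : ℝ) ≤
        (wordCount {w : List α | posT T w = 0} (2 * n) : ℝ) +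
        (wordCount {w : List α | posT T w = y} (2 * n) : ℝ) := by
      exact_mod_cast wc_union _ _ _
    refine h1.trans ?_
    rw [hwc, hwc]
    have a1 := mul_le_mul_of_nonneg_left (hup n hn 0)
      (by positivity : 0 ≤ (Fintype.card α : ℝ) ^ (2 * n))
    have a2 := mul_le_mul_of_nonneg_left (hup n hn y)
      (by positivity : 0 ≤ (Fintype.card α : ℝ) ^ (2 * n))
    linarith
  · rintro ⟨B, ρ, hB, hρ, hρ1, hb⟩
    have key : ∀ n : ℕ, 1 ≤ n → c / B ≤ n * (ρ ^ 2) ^ n := by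
      intro n hn
      have hn1 : (1:ℝ) ≤ n := by exact_mod_cast hn
      have h2 := (low n hn).trans (hb (2 * n))
      have h3 : c * (n : ℝ) ^ (-(1/2) : ℝ) ≤ B * ρ ^ (2 * n) :=
        le_of_mul_le_mul_right h2 (by positivity)
      have h4 : (n:ℝ)⁻¹ ≤ (n : ℝ) ^ (-(1/2) : ℝ) := by
        rw [← Real.rpow_neg_one]
        exact Real.rpow_le_rpow_of_exponent_le hn1 (by norm_num)
      have h5 : c * (n:ℝ)⁻¹ ≤ B * ρ ^ (2 * n) := (mul_le_mul_of_nonneg_left h4 hc.le).trans h3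
      rw [← div_eq_mul_inv, div_le_iff₀ (by linarith)] at h5
      rw [div_le_iff₀ hB, ← pow_mul]
      linarith
    have lim := tendsto_self_mul_const_pow_of_lt_one (r := ρ ^ 2) (by positivity)
      (pow_lt_one₀ hρ.le hρ1 (by norm_num))
    have : c / B ≤ 0 := ge_of_tendsto lim (Filter.eventually_atTop.2 ⟨1, key⟩)
    have : 0 < c / B := by positivity
    linarith
end

/-- Let `G = H ∗_A K` with `[H:A] = [K:A] = 2`, fix `h ∈ H \ A` and
`k ∈ K \ A`, let `P` be the canonical image of `H` or of `K`, and let `η : Σ → G` be a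
finite symmetric generating set with `η(Σ) ⊆ A ∪ {h, h⁻¹, k, k⁻¹}` (inside `G`). Then the
number of words of length `2n` representing an element of `P` lies between
`c₁·n^{-1/2}·|Σ|^{2n}` and `c₂·n^{-1/2}·|Σ|^{2n}` for constants `c₁, c₂ > 0`; in
particular this set of words is not strongly negligible. -/
theorem stmt_8 {A : Type*} {H K : Type u} [Group A] [Group H] [Group K]
    (φ : A →* H) (ψ : A →* K) (hφ : Function.Injective φ) (hψ : Function.Injective ψ)
    (hH2 : φ.range.index = 2) (hK2 : ψ.range.index = 2)
    (h : H) (hh : h ∉ φ.range) (k : K) (hk : k ∉ ψ.range)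
    (P : Subgroup (AmalgProd φ ψ))
    (hP : P = (amalgH φ ψ).range ∨ P = (amalgK φ ψ).range)
    {α : Type*} [Fintype α] (η : α → AmalgProd φ ψ) (inv : α → α)
    (hsym : IsSymmetricGen η inv)
    (hrange : ∀ a : α, η a ∈ (((amalgH φ ψ).comp φ).range : Set (AmalgProd φ ψ)) ∪
      {amalgH φ ψ h, (amalgH φ ψ h)⁻¹, amalgK φ ψ k, (amalgK φ ψ k)⁻¹}) :
    (∃ c₁ c₂ : ℝ, 0 < c₁ ∧ 0 < c₂ ∧ ∀ n : ℕ, 1 ≤ n →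
      c₁ * (n : ℝ) ^ (-(1/2) : ℝ) * (Fintype.card α : ℝ) ^ (2 * n) ≤
        (wordCount {w : List α | evalWord η w ∈ P} (2 * n) : ℝ) ∧
      (wordCount {w : List α | evalWord η w ∈ P} (2 * n) : ℝ) ≤
        c₂ * (n : ℝ) ^ (-(1/2) : ℝ) * (Fintype.card α : ℝ) ^ (2 * n)) ∧
    ¬ StronglyNegligible {w : List α | evalWord η w ∈ P} := by
  classical
  set T : α → Equiv.Perm ℤ := fun a => th φ ψ hH2 hK2 (η a) with hTdef
  have hT : ∀ a, T a = 1 ∨ T a = sig ∨ T a = tau := by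
    intro a
    rcases letter_cases φ ψ hH2 hK2 h hh k hk (η a) (hrange a) with h1 | h1 | h1
    · exact Or.inl h1.1
    · exact Or.inr (Or.inl h1.1)
    · exact Or.inr (Or.inr h1.1)
  have hpos : ∀ w : List α, th φ ψ hH2 hK2 (evalWord η w) 0 = posT T w := by
    intro w
    simp [evalWord, posT, map_list_prod, hTdef, Function.comp_def]
  obtain ⟨-, -, -, hgen⟩ := hsym
  have hsig : ∃ a, T a = sig := by
    by_contra! hn
    have : Subgroup.closure (Set.range η) ≤
        (Subgroup.centralizer {tau}).comap (th φ ψ hH2 hK2) := by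
      rw [Subgroup.closure_le]
      rintro _ ⟨a, rfl⟩
      simp only [Subgroup.coe_comap, Set.mem_preimage, SetLike.mem_coe,
        Subgroup.mem_centralizer_singleton_iff]
      change T a * tau = tau * T a
      rcases hT a with h1 | h1 | h1
      · rw [h1]; simp
      · exact absurd h1 (hn a)
      · rw [h1]
    rw [hgen] at this
    have h2 := this (Subgroup.mem_top (amalgH φ ψ h))
    rw [Subgroup.mem_comap, th_H, if_neg hh, Subgroup.mem_centralizer_singleton_iff] at h2
    exact sig_tau_ne h2
  have htau : ∃ a, T a = tau := by
    by_contra! hn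
    have : Subgroup.closure (Set.range η) ≤
        (Subgroup.centralizer {sig}).comap (th φ ψ hH2 hK2) := by
      rw [Subgroup.closure_le]
      rintro _ ⟨a, rfl⟩
      simp only [Subgroup.coe_comap, Set.mem_preimage, SetLike.mem_coe,
        Subgroup.mem_centralizer_singleton_iff]
      change T a * sig = sig * T a
      rcases hT a with h1 | h1 | h1
      · rw [h1]; simp
      · rw [h1]
      · exact absurd h1 (hn a)
    rw [hgen] at this
    have h2 := this (Subgroup.mem_top (amalgK φ ψ k))
    rw [Subgroup.mem_comap, th_K, if_neg hk, Subgroup.mem_centralizer_singleton_iff] at h2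
    exact sig_tau_ne h2.symm
  have hL : ∃ y : ℤ, {w : List α | evalWord η w ∈ P} =
      {w | posT T w = 0} ∪ {w | posT T w = y} := by
    rcases hP with rfl | rfl
    · refine ⟨1, ?_⟩
      ext w
      simp only [Set.mem_ofPred_eq, Set.mem_union]
      rw [mem_H_iff φ ψ hH2 hK2 h hh k hk η hrange, hpos]
    · refine ⟨-1, ?_⟩
      ext w
      simp only [Set.mem_ofPred_eq, Set.mem_union]
      rw [mem_K_iff φ ψ hH2 hK2 h hh k hk η hrange, hpos]
  obtain ⟨y, hL⟩ := hL
  rw [hL]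
  exact main_count T hT hsig htau y
end
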